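/- Let (v,f,φ) be a structure on an open set U compactly contained in P with v₁ ≢ 0, and let F := F[v,f] = ∇p[0,f] − ∇p[v,f]. Then: (i) F ∈ C^∞(ℝ²;ℝ²) and lim_{x₁→+∞} x₁⁴ F₁(x₁,0) = D and lim_{x₁→−∞} x₁⁴ F₁(x₁,0) = −D, where D := (9/4π) ∫_{ℝ³} v₁(y₁, √(y₂²+y₃²))² dy > 0 (with v₁ extended by zero); (ii) F₁ restricted to the x₁-axis attains a positive maximum: there exist B > 0 and A ∈ ℝ with B = F₁(A,0) = max_{x₁∈ℝ} F₁(x₁,0); (iii) there exists C > 0 such that |F(x)| ≤ C/|x|⁴ and |∇F(x)| ≤ C/|x|⁵ for all x ∈ ℝ² ∖ {0}; (iv) F₂(x₁,0) = 0 for all x₁ ∈ ℝ; (v) setting κ := 10⁴ C/D, there exists N > 0 such that for all n ≥ N, if |x₁ − n| < κ and |x₂| < 1 then |F₁(x₁,x₂) − n⁻⁴D| ≤ 0.001 n⁻⁴D. -/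

import Mathlib

noncomputable section

open MeasureTheory Real Set Filter Topology

abbrev E3 : Type := EuclideanSpace ℝ (Fin 3)

/-- The point of `ℝ³` with coordinates `(a, b, c)`. -/
def e3 (a b c : ℝ) : E3 := (EuclideanSpace.equiv (Fin 3) ℝ).symm ![a, b, c]

/-- Spatial partial derivative `∂ᵢ w`. -/
def pd3 (w : E3 → ℝ) (i : Fin 3) (x : E3) : ℝ := fderiv ℝ w x (EuclideanSpace.single i 1)

/-- Laplacian of a scalar function on `ℝ³`. -/
def lap3 (w : E3 → ℝ) (x : E3) : ℝ := ∑ i : Fin 3, pd3 (fun y => pd3 w i y) i x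

/-- Divergence of a vector field on `ℝ³`. -/
def div3 (u : E3 → E3) (x : E3) : ℝ := ∑ i : Fin 3, pd3 (fun y => u y i) i x

/-- `|∇u|²`. -/
def gradsq (u : E3 → E3) (x : E3) : ℝ :=
  ∑ i : Fin 3, ∑ j : Fin 3, (pd3 (fun y => u y j) i x) ^ 2

/-- The pressure function corresponding to a vector field `u`. -/
def pressureFn (u : E3 → E3) (x : E3) : ℝ :=
  ∫ y : E3, (∑ i : Fin 3, ∑ j : Fin 3,
    pd3 (fun z => u z j) i y * pd3 (fun z => u z i) j y) / (4 * π * ‖x - y‖)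

/-- Rotation about the `x₁` axis by angle `θ`. -/
def rot3 (θ : ℝ) (x : E3) : E3 :=
  e3 (x 0) (x 1 * Real.cos θ - x 2 * Real.sin θ) (x 1 * Real.sin θ + x 2 * Real.cos θ)

abbrev Pt : Type := ℝ × ℝ

/-- The open upper half-plane `P`. -/
def Pset : Set Pt := {p | 0 < p.2}

def pdx (g : Pt → ℝ) (p : Pt) : ℝ := fderiv ℝ g p (1, 0)

def pdy (g : Pt → ℝ) (p : Pt) : ℝ := fderiv ℝ g p (0, 1)

/-- The operator `L`, `Lg = Δg + ∂₂ g / x₂ - g / x₂²`. -/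
def Lop (g : Pt → ℝ) (p : Pt) : ℝ :=
  (pdx (fun q => pdx g q) p + pdy (fun q => pdy g q) p) + pdy g p / p.2 - g p / p.2 ^ 2

/-- `div (x₂ v(x₁,x₂))` for a planar vector field `v = (w₁, w₂)`. -/
def div2w (w₁ w₂ : Pt → ℝ) (p : Pt) : ℝ :=
  pdx (fun q => q.2 * w₁ q) p + pdy (fun q => q.2 * w₂ q) p

/-- `g ∈ C₀^∞(P)`. -/
def SmoothCompSuppP (g : Pt → ℝ) : Prop :=
  ContDiff ℝ (⊤ : ℕ∞) g ∧ HasCompactSupport g ∧ tsupport g ⊆ Pset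

/-- Distance to the `x₁`-axis. -/
def rad (x : E3) : ℝ := Real.sqrt ((x 1) ^ 2 + (x 2) ^ 2)

/-- The cylindrical projection `R⁻¹`. -/
def Rinv (x : E3) : Pt := (x 0, rad x)

/-- The rotation `R(V)` of a subset `V` of the (closed) upper half-plane. -/
def Rset (V : Set Pt) : Set E3 := {x | Rinv x ∈ V}

def wcomp (v₁ v₂ f : Pt → ℝ) (p : Pt) : ℝ := Real.sqrt (f p ^ 2 - (v₁ p ^ 2 + v₂ p ^ 2))

/-- The axisymmetric vector field `u[v,f]` determined (in cylindrical coordinates) by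
`u[v,f](x₁,x₂,0) = (v₁(x₁,x₂), v₂(x₁,x₂), √(f(x₁,x₂)² − |v(x₁,x₂)|²))` for `x₂ ≥ 0`. -/
def uvf (v₁ v₂ f : Pt → ℝ) (x : E3) : E3 :=
  e3 (v₁ (Rinv x))
    (v₂ (Rinv x) * (x 1 / rad x) - wcomp v₁ v₂ f (Rinv x) * (x 2 / rad x))
    (v₂ (Rinv x) * (x 2 / rad x) + wcomp v₁ v₂ f (Rinv x) * (x 1 / rad x))

/-- The planar pressure function `p[v,f]`, the restriction to `{x₃ = 0}` of the pressure
function `p*[v,f]` corresponding to `u[v,f]`. -/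
def pvf (v₁ v₂ f : Pt → ℝ) (q : Pt) : ℝ := pressureFn (uvf v₁ v₂ f) (e3 q.1 q.2 0)

def zf : Pt → ℝ := fun _ => 0

/-- First component of the pressure interaction function `F[v,f] = ∇p[0,f] − ∇p[v,f]`. -/
def Fpi1 (v₁ v₂ f : Pt → ℝ) (q : Pt) : ℝ := pdx (pvf zf zf f) q - pdx (pvf v₁ v₂ f) q

/-- Second component of the pressure interaction function `F[v,f] = ∇p[0,f] − ∇p[v,f]`. -/
def Fpi2 (v₁ v₂ f : Pt → ℝ) (q : Pt) : ℝ := pdy (pvf zf zf f) q - pdy (pvf v₁ v₂ f) q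

/-- A structure `(v, f, φ)` (with `v = (w₁,w₂)`) on a set `U ⋐ P`. -/
structure StructureOn (U : Set Pt) (w₁ w₂ f φ : Pt → ℝ) : Prop where
  smooth_w₁ : ContDiff ℝ (⊤ : ℕ∞) w₁
  smooth_w₂ : ContDiff ℝ (⊤ : ℕ∞) w₂
  smooth_f : ContDiff ℝ (⊤ : ℕ∞) f
  smooth_phi : ContDiff ℝ (⊤ : ℕ∞) φ
  hcs_w₁ : HasCompactSupport w₁
  hcs_w₂ : HasCompactSupport w₂
  hcs_f : HasCompactSupport f
  hcs_phi : HasCompactSupport φ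
  supp_w₁ : tsupport w₁ ⊆ {p | φ p = 1}
  supp_w₂ : tsupport w₂ ⊆ {p | φ p = 1}
  supp_f : tsupport f = closure U
  f_nonneg : ∀ p, 0 ≤ f p
  phi_mem : ∀ p, φ p ∈ Icc (0:ℝ) 1
  supp_phi : tsupport φ ⊆ U
  div_v : ∀ p ∈ U, div2w w₁ w₂ p = 0
  f_gt : ∀ p ∈ U, Real.sqrt (w₁ p ^ 2 + w₂ p ^ 2) < f p
  Lf_pos : ∀ p ∈ U, φ p ≠ 1 → 0 < Lop f p

/-- `u` is a weak solution of the Navier–Stokes inequality with viscosity `ν`: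
the local energy inequality holds against every nonnegative test function
`φ ∈ C₀^∞(ℝ³ × (0,∞))`. -/
def IsWeakNSI (ν : ℝ) (u : E3 → ℝ → E3) : Prop :=
  ∀ φ : E3 × ℝ → ℝ, ContDiff ℝ (⊤ : ℕ∞) φ → HasCompactSupport φ →
    tsupport φ ⊆ {z : E3 × ℝ | 0 < z.2} → (∀ z, 0 ≤ φ z) →
    2 * ν * (∫ t in Ioi (0:ℝ), ∫ x : E3, gradsq (fun y => u y t) x * φ (x, t)) ≤
      ∫ t in Ioi (0:ℝ), ∫ x : E3,
        (‖u x t‖ ^ 2 * (deriv (fun s => φ (x, s)) t + ν * lap3 (fun y => φ (y, t)) x)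
          + (‖u x t‖ ^ 2 + 2 * pressureFn (fun y => u y t) x) *
              (∑ i : Fin 3, u x t i * pd3 (fun y => φ (y, t)) i x))

/-- The regularity `sup_{t>0} ‖u(t)‖_{L²} < ∞` and `∇u ∈ L²(ℝ³ × (0,∞))`. -/
def NSIRegular (u : E3 → ℝ → E3) : Prop :=
  (∃ M : ℝ, ∀ t, 0 < t →
    Integrable (fun x : E3 => ‖u x t‖ ^ 2) ∧ (∫ x : E3, ‖u x t‖ ^ 2) ≤ M) ∧
  IntegrableOn (fun z : E3 × ℝ => gradsq (fun y => u y z.2) z.1) (univ ×ˢ Ioi 0)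

/-- `u` is unbounded in every neighbourhood of `(x₀, T₀)`. -/
def UnboundedNear (u : E3 → ℝ → E3) (x₀ : E3) (T₀ : ℝ) : Prop :=
  ∀ ε > 0, ∀ M : ℝ, ∃ x : E3, ∃ t : ℝ, 0 < t ∧ ‖x - x₀‖ < ε ∧ |t - T₀| < ε ∧ M < ‖u x t‖

/-- The singular set of `u`. -/
def SingularSet (u : E3 → ℝ → E3) : Set (E3 × ℝ) :=
  {z | 0 < z.2 ∧ UnboundedNear u z.1 z.2}

/-- `u · (∂_t u + (u·∇)u + ∇p)`, where `p` is the pressure corresponding to `u(·,t)`. -/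
def eulerOp (u : E3 → ℝ → E3) (x : E3) (t : ℝ) : ℝ :=
  ∑ j : Fin 3, u x t j *
    (deriv (fun s => u x s j) t
      + (∑ i : Fin 3, u x t i * pd3 (fun y => u y t j) i x)
      + pd3 (pressureFn (fun y => u y t)) j x)

/-- `u · (∂_t u − νΔu + (u·∇)u + ∇p)`, where `p` is the pressure corresponding to `u(·,t)`. -/
def nsOp (ν : ℝ) (u : E3 → ℝ → E3) (x : E3) (t : ℝ) : ℝ :=
  ∑ j : Fin 3, u x t j *
    (deriv (fun s => u x s j) t - ν * lap3 (fun y => u y t j) x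
      + (∑ i : Fin 3, u x t i * pd3 (fun y => u y t j) i x)
      + pd3 (pressureFn (fun y => u y t)) j x)

/-- The time-dependent modification `h_{1,t}` of `f₁`. -/
def h1d (f₁ φ₁ : Pt → ℝ) (δ t : ℝ) (p : Pt) : ℝ :=
  Real.sqrt (f₁ p ^ 2 - 2 * t * δ * φ₁ p)

/-- The time-dependent modification `h_{2,t}` of `f₂`. -/
def h2d (w₁ w₂ f₁ φ₁ b₁ b₂ f₂ φ₂ : Pt → ℝ) (δ t : ℝ) (p : Pt) : ℝ :=
  Real.sqrt (f₂ p ^ 2 - 2 * t * δ * φ₂ p +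
    ∫ s in (0:ℝ)..t,
      (b₁ p * Fpi1 w₁ w₂ (h1d f₁ φ₁ δ s) p + b₂ p * Fpi2 w₁ w₂ (h1d f₁ φ₁ δ s) p))

/-- The constant `D` of Lemma 3.4 (i). -/
def Dconst (w₁ : Pt → ℝ) : ℝ := (9 / (4 * π)) * ∫ y : E3, (w₁ (Rinv y)) ^ 2

/-- A (planar, open) rectangle. -/
def IsRect (V : Set Pt) : Prop :=
  ∃ a₁ b₁ a₂ b₂ : ℝ, a₁ < b₁ ∧ a₂ < b₂ ∧ V = Ioo a₁ b₁ ×ˢ Ioo a₂ b₂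

/-- Smooth compactly supported scalar functions on `ℝ³`. -/
structure TestFn (g : E3 → ℝ) : Prop where
  smooth : ContDiff ℝ (⊤ : ℕ∞) g
  compact : HasCompactSupport g

/-- Kernels smooth away from the origin and positively homogeneous of degree `-m`. -/
structure HomKernel (m : ℕ) (k : E3 → ℝ) : Prop where
  smooth : ContDiffOn ℝ (⊤ : ℕ∞) k {0}ᶜ
  hom : ∀ c : ℝ, 0 < c → ∀ z : E3, z ≠ 0 → k (c • z) = c⁻¹ ^ m * k z

/-- The potential of `g` with kernel `k`. -/
def kpot (k g : E3 → ℝ) (x : E3) : ℝ := ∫ y, k (x - y) * g y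

/-- The fundamental solution `1 / (4π|z|)`. -/
def newton (z : E3) : ℝ := 1 / (4 * π * ‖z‖)

lemma contDiff_pd3 {g : E3 → ℝ} (hg : ContDiff ℝ (⊤ : ℕ∞) g) (i : Fin 3) :
    ContDiff ℝ (⊤ : ℕ∞) (pd3 g i) :=
  (hg.fderiv_right (m := (⊤ : ℕ∞)) (by simp)).clm_apply contDiff_const

lemma tsupport_pd3_subset (g : E3 → ℝ) (i : Fin 3) : tsupport (pd3 g i) ⊆ tsupport g :=
  tsupport_fderiv_apply_subset ℝ _

lemma TestFn.pd3 {g : E3 → ℝ} (hg : TestFn g) (i : Fin 3) : TestFn (pd3 g i) :=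
  ⟨contDiff_pd3 hg.smooth i, hg.compact.fderiv_apply ℝ _⟩

lemma TestFn.integrable {g : E3 → ℝ} (hg : TestFn g) : Integrable g :=
  hg.smooth.continuous.integrable_of_hasCompactSupport hg.compact

lemma TestFn.mul {g h : E3 → ℝ} (hg : TestFn g) (hh : TestFn h) : TestFn (fun x => g x * h x) :=
  ⟨hg.smooth.mul hh.smooth, hg.compact.mul_right⟩

lemma TestFn.add {g h : E3 → ℝ} (hg : TestFn g) (hh : TestFn h) : TestFn (fun x => g x + h x) :=
  ⟨hg.smooth.add hh.smooth, hg.compact.add hh.compact⟩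

lemma TestFn.neg {g : E3 → ℝ} (hg : TestFn g) : TestFn (fun x => - g x) :=
  ⟨hg.smooth.neg, hg.compact.neg⟩

lemma TestFn.sub {g h : E3 → ℝ} (hg : TestFn g) (hh : TestFn h) : TestFn (fun x => g x - h x) := by
  simpa [sub_eq_add_neg] using hg.add hh.neg

lemma TestFn.exists_tsupport_subset {g : E3 → ℝ} (hg : TestFn g) :
    ∃ R : ℝ, 0 < R ∧ tsupport g ⊆ Metric.closedBall 0 R := by
  obtain ⟨R, hR⟩ := hg.compact.isBounded.subset_closedBall 0
  exact ⟨max R 1, by positivity, hR.trans (Metric.closedBall_subset_closedBall (le_max_left _ _))⟩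

lemma HomKernel.differentiableAt {m : ℕ} {k : E3 → ℝ} (hk : HomKernel m k) {z : E3} (hz : z ≠ 0) :
    DifferentiableAt ℝ k z :=
  (hk.smooth.contDiffAt (isOpen_compl_singleton.mem_nhds hz)).differentiableAt (by simp)

lemma HomKernel.pd3 {m : ℕ} {k : E3 → ℝ} (hk : HomKernel m k) (i : Fin 3) :
    HomKernel (m + 1) (pd3 k i) := by
  refine ⟨?_, ?_⟩
  · exact (hk.smooth.fderiv_of_isOpen (m := (⊤ : ℕ∞)) isOpen_compl_singleton (by simp)).clm_apply
      contDiffOn_const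
  · intro c hc z hz
    have hcz : c • z ≠ 0 := smul_ne_zero hc.ne' hz
    have h1 : HasFDerivAt (fun w : E3 => k (c • w)) (c • fderiv ℝ k (c • z)) z := by
      have := (hk.differentiableAt hcz).hasFDerivAt.comp z
        ((hasFDerivAt_id (𝕜 := ℝ) z).const_smul c)
      convert! this using 1
      ext; simp
    have h2 : HasFDerivAt (fun w : E3 => k (c • w)) (c⁻¹ ^ m • fderiv ℝ k z) z := by
      refine ((hk.differentiableAt hz).hasFDerivAt.const_mul (c⁻¹ ^ m)).congr_of_eventuallyEq ?_
      filter_upwards [isOpen_compl_singleton.mem_nhds hz] with w hw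
      exact hk.hom c hc w hw
    have h3 := congrArg (fun T : E3 →L[ℝ] ℝ => T (EuclideanSpace.single i 1)) (h1.unique h2)
    simp only [smul_apply, smul_eq_mul] at h3
    simp only [_root_.pd3]
    rw [pow_succ]
    field_simp at h3 ⊢
    linarith

lemma HomKernel.bound {m : ℕ} {k : E3 → ℝ} (hk : HomKernel m k) :
    ∃ C : ℝ, 0 ≤ C ∧ ∀ z : E3, z ≠ 0 → |k z| ≤ C / ‖z‖ ^ m := by
  have hsub : Metric.sphere (0 : E3) 1 ⊆ {0}ᶜ := by
    intro z hz h
    simp only [mem_singleton_iff] at h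
    simp [h] at hz
  obtain ⟨C, hC⟩ := (isCompact_sphere (0 : E3) 1).exists_bound_of_continuousOn
    (hk.smooth.continuousOn.mono hsub)
  refine ⟨max C 0, le_max_right _ _, fun z hz => ?_⟩
  have hn : 0 < ‖z‖ := norm_pos_iff.2 hz
  have h1 : ‖(‖z‖⁻¹ • z)‖ = 1 := by
    rw [norm_smul, norm_inv, norm_norm, inv_mul_cancel₀ hn.ne']
  have h2 := hC (‖z‖⁻¹ • z) (by simpa using h1)
  rw [hk.hom _ (inv_pos.2 hn) z hz, inv_inv, Real.norm_eq_abs, abs_mul, abs_of_nonneg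
    (by positivity)] at h2
  rw [le_div_iff₀ (by positivity), mul_comm]
  exact h2.trans (le_max_left _ _)

lemma homKernel_newton : HomKernel 1 newton := by
  refine ⟨?_, ?_⟩
  · unfold newton
    refine contDiffOn_const.div (contDiffOn_const.mul (fun z hz => ?_)) ?_
    · exact (contDiffAt_norm ℝ hz).contDiffWithinAt
    · intro z hz
      have : 0 < ‖z‖ := norm_pos_iff.2 hz
      positivity
  · intro c hc z hz
    have : 0 < ‖z‖ := norm_pos_iff.2 hz
    simp only [newton, norm_smul, Real.norm_eq_abs, abs_of_pos hc]
    field_simp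

lemma locallyIntegrable_newton : LocallyIntegrable newton (volume : Measure E3) := by
  have key : ∀ r : ℝ, IntegrableOn newton (Metric.ball (0 : E3) r) := by
    intro r
    have := (integrableOn_fun_norm_addHaar (E := E3) volume (f := fun t : ℝ => 1 / (4 * π * t))
      (r := r)).2
    refine this ?_
    have h2 : IntegrableOn (fun y : ℝ => (1 / (4 * π)) * y) (Ioo 0 r) :=
      (((continuous_const.mul continuous_id).continuousOn).integrableOn_Icc).mono_set
        Ioo_subset_Icc_self
    refine h2.congr_fun (fun y hy => ?_) measurableSet_Ioo
    have : y ≠ 0 := hy.1.ne'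
    simp
    field_simp
  intro x
  refine ⟨Metric.ball 0 (‖x‖ + 1), Metric.isOpen_ball.mem_nhds (by simp), key _⟩

section Potential
open scoped Convolution

lemma kpot_eq_convolution (k g : E3 → ℝ) :
    kpot k g = (k ⋆[ContinuousLinearMap.lsmul ℝ ℝ, volume] g) := by
  ext x
  rw [convolution_lsmul_swap]
  simp [kpot]

lemma contDiff_kpot {k g : E3 → ℝ} (hk : LocallyIntegrable k) (hg : TestFn g) :
    ContDiff ℝ (⊤ : ℕ∞) (kpot k g) := by
  rw [kpot_eq_convolution]
  exact hg.compact.contDiff_convolution_right _ hk hg.smooth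

lemma pd3_kpot {k g : E3 → ℝ} (hk : LocallyIntegrable k) (hg : TestFn g) (i : Fin 3) :
    pd3 (kpot k g) i = kpot k (pd3 g i) := by
  ext x
  have h1 := (hg.compact.hasFDerivAt_convolution_right (ContinuousLinearMap.lsmul ℝ ℝ) hk
    (hg.smooth.of_le (by simp)) x).fderiv
  rw [pd3, kpot_eq_convolution, kpot_eq_convolution, h1, convolution_precompR_apply]
  · rfl
  · exact hk
  · exact hg.compact.fderiv ℝ
  · exact hg.smooth.continuous_fderiv (by simp)

end Potential

lemma integrable_kernel_mul {k g : E3 → ℝ} {x : E3} (hk : ContinuousOn k {0}ᶜ)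
    (hg : Continuous g) (hc : HasCompactSupport g) (hx : x ∉ tsupport g) :
    Integrable (fun y => k (x - y) * g y) := by
  refine Continuous.integrable_of_hasCompactSupport ?_ hc.mul_left
  refine ContinuousOn.continuous_of_tsupport_subset (s := {x}ᶜ) ?_ isOpen_compl_singleton ?_
  · refine ContinuousOn.mul (hk.comp (by fun_prop) ?_) hg.continuousOn
    intro y hy h
    exact hy (sub_eq_zero.1 h).symm
  · intro y hy h
    rw [mem_singleton_iff] at h
    subst h
    exact hx (tsupport_mul_subset_right hy)

lemma TestFn.integrable_kernel_mul {m : ℕ} {k g : E3 → ℝ} {x : E3} (hk : HomKernel m k)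
    (hg : TestFn g) (hx : x ∉ tsupport g) : Integrable (fun y => k (x - y) * g y) :=
  _root_.integrable_kernel_mul hk.smooth.continuousOn hg.smooth.continuous hg.compact hx

/-- Integration by parts: away from the support of the density, derivatives may be moved onto
the kernel. -/
lemma kpot_pd3 {m : ℕ} {k g : E3 → ℝ} {x : E3} (hk : HomKernel m k) (hg : TestFn g)
    (hx : x ∉ tsupport g) (i : Fin 3) : kpot k (pd3 g i) x = kpot (pd3 k i) g x := by
  have hd : ∀ y ∈ tsupport g, HasFDerivAt (fun y => k (x - y)) (-(fderiv ℝ k (x - y))) y := by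
    intro y hy
    have hne : x - y ≠ 0 := fun h => hx ((sub_eq_zero.1 h) ▸ hy)
    have := (hk.differentiableAt hne).hasFDerivAt.comp y ((hasFDerivAt_id (𝕜 := ℝ) y).const_sub x)
    convert! this using 1
    ext; simp
  have h := integral_bilinear_hasFDerivAt_right_eq_neg_left_of_integrable (μ := volume)
    (B := ContinuousLinearMap.mul ℝ ℝ) (f := fun y => k (x - y))
    (f' := fun y => -(fderiv ℝ k (x - y))) (g := g) (g' := fderiv ℝ g)
    (v := EuclideanSpace.single i 1) ?_ ?_ ?_ hd
    (fun y _ => (hg.smooth.differentiable (by simp) y).hasFDerivAt)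
  · simp only [ContinuousLinearMap.mul_apply', neg_apply, neg_mul,
      integral_neg, neg_neg] at h
    exact h
  · have := (hg.integrable_kernel_mul (hk.pd3 i) hx).neg
    refine this.congr (.of_forall fun y => ?_)
    simp [pd3]
  · exact (hg.pd3 i).integrable_kernel_mul hk (fun h => hx (tsupport_pd3_subset g i h))
  · exact hg.integrable_kernel_mul hk hx

lemma kpot_bound {m : ℕ} {k g : E3 → ℝ} (hk : HomKernel m k) (hg : TestFn g) :
    ∃ C R : ℝ, ∀ x, R < ‖x‖ → |kpot k g x| ≤ C / ‖x‖ ^ m := by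
  obtain ⟨C, hC0, hC⟩ := hk.bound
  obtain ⟨R, hR0, hR⟩ := hg.exists_tsupport_subset
  refine ⟨2 ^ m * C * ∫ y, |g y|, 2 * R, fun x hx => ?_⟩
  have hxp : 0 < ‖x‖ := by linarith
  have h1 : ‖kpot k g x‖ ≤ ∫ y, (2 ^ m * C / ‖x‖ ^ m) * |g y| := by
    refine norm_integral_le_of_norm_le (hg.integrable.abs.const_mul _) (.of_forall fun y => ?_)
    by_cases hy : y ∈ tsupport g
    · rw [norm_mul, Real.norm_eq_abs, Real.norm_eq_abs]
      refine mul_le_mul_of_nonneg_right ?_ (abs_nonneg _)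
      have hyR : ‖y‖ ≤ R := by simpa using hR hy
      have hge : ‖x‖ / 2 ≤ ‖x - y‖ := by
        have := norm_sub_norm_le x y
        linarith
      have hne : x - y ≠ 0 := norm_pos_iff.1 (by linarith)
      refine (hC _ hne).trans ?_
      calc C / ‖x - y‖ ^ m ≤ C / (‖x‖ / 2) ^ m := by gcongr
        _ = 2 ^ m * C / ‖x‖ ^ m := by rw [div_pow]; field_simp
    · simp [image_eq_zero_of_notMem_tsupport hy]
  rw [integral_const_mul] at h1
  rw [← Real.norm_eq_abs]
  refine h1.trans (le_of_eq ?_)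
  ring

lemma HomKernel.norm_fderiv_bound {m : ℕ} {k : E3 → ℝ} (hk : HomKernel m k) :
    ∃ C : ℝ, 0 ≤ C ∧ ∀ z : E3, z ≠ 0 → ‖fderiv ℝ k z‖ ≤ C / ‖z‖ ^ (m + 1) := by
  choose C hC0 hC using fun i => (hk.pd3 i).bound
  refine ⟨∑ i, C i, Finset.sum_nonneg fun i _ => hC0 i, fun z hz => ?_⟩
  refine ContinuousLinearMap.opNorm_le_bound _
    (div_nonneg (Finset.sum_nonneg fun i _ => hC0 i) (by positivity)) fun w => ?_
  have hw : w = ∑ i, w i • EuclideanSpace.single i (1 : ℝ) := by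
    ext j
    fin_cases j <;> simp [Fin.sum_univ_three]
  conv_lhs => rw [hw]
  rw [map_sum, Finset.sum_div, Finset.sum_mul]
  refine norm_sum_le_of_le _ fun i _ => ?_
  rw [map_smul, norm_smul, mul_comm]
  exact mul_le_mul (hC i z hz) (PiLp.norm_apply_le w i) (norm_nonneg _)
    (div_nonneg (hC0 i) (by positivity))

/-- Leading order of a potential at infinity. -/
lemma kpot_leading {m : ℕ} {k g : E3 → ℝ} (hk : HomKernel m k) (hg : TestFn g) :
    ∃ C R : ℝ, ∀ x, R < ‖x‖ → |kpot k g x - k x * ∫ y, g y| ≤ C / ‖x‖ ^ (m + 1) := by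
  obtain ⟨C, hC0, hC⟩ := hk.norm_fderiv_bound
  obtain ⟨R, hR0, hR⟩ := hg.exists_tsupport_subset
  refine ⟨2 ^ (m + 1) * C * R * ∫ y, |g y|, 2 * R, fun x hx => ?_⟩
  have hxp : 0 < ‖x‖ := by linarith
  have hxs : x ∉ tsupport g := fun h => by
    have := hR h
    simp at this
    linarith
  have heq : kpot k g x - k x * ∫ y, g y = ∫ y, (k (x - y) - k x) * g y := by
    rw [kpot, ← integral_const_mul, ← integral_sub (hg.integrable_kernel_mul hk hxs)
      (hg.integrable.const_mul _)]
    simp only [sub_mul]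
  have h1 : ‖∫ y, (k (x - y) - k x) * g y‖ ≤ ∫ y, (2 ^ (m + 1) * C / ‖x‖ ^ (m + 1) * R) * |g y| := by
    refine norm_integral_le_of_norm_le (hg.integrable.abs.const_mul _) (.of_forall fun y => ?_)
    by_cases hy : y ∈ tsupport g
    · rw [norm_mul, Real.norm_eq_abs (g y)]
      refine mul_le_mul_of_nonneg_right ?_ (abs_nonneg _)
      have hyR : ‖y‖ ≤ R := by simpa using hR hy
      have hge : ∀ z ∈ Metric.closedBall x R, ‖x‖ / 2 ≤ ‖z‖ := by
        intro z hz
        have h3 := norm_sub_norm_le x z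
        rw [Metric.mem_closedBall, dist_comm, dist_eq_norm] at hz
        linarith
      have hne : ∀ z ∈ Metric.closedBall x R, z ≠ 0 := fun z hz =>
        norm_pos_iff.1 (by linarith [hge z hz])
      have hmv := (convex_closedBall x R).norm_image_sub_le_of_norm_fderiv_le (𝕜 := ℝ) (f := k)
        (C := 2 ^ (m + 1) * C / ‖x‖ ^ (m + 1)) (x := x) (y := x - y)
        (fun z hz => hk.differentiableAt (hne z hz)) (fun z hz => ?_)
        (Metric.mem_closedBall_self hR0.le) (by simpa [dist_eq_norm] using hyR)
      · refine hmv.trans (mul_le_mul_of_nonneg_left ?_ (by positivity))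
        simpa using hyR
      · have hz2 := hge z hz
        calc ‖fderiv ℝ k z‖ ≤ C / ‖z‖ ^ (m + 1) := hC z (hne z hz)
          _ ≤ C / (‖x‖ / 2) ^ (m + 1) := by gcongr
          _ = _ := by rw [div_pow]; field_simp
    · simp [image_eq_zero_of_notMem_tsupport hy]
  rw [heq, ← Real.norm_eq_abs]
  refine h1.trans (le_of_eq ?_)
  rw [integral_const_mul]
  ring

lemma pd3_eq_of_hasLineDerivAt {g : E3 → ℝ} {x : E3} {i : Fin 3} {d : ℝ}
    (hg : DifferentiableAt ℝ g x)
    (h : HasDerivAt (fun t : ℝ => g (x + t • EuclideanSpace.single i (1 : ℝ))) d 0) :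
    pd3 g i x = d := by
  rw [pd3, ← hg.lineDeriv_eq_fderiv]
  exact HasLineDerivAt.lineDeriv h

lemma hasDerivAt_line_apply (x : E3) (i a : Fin 3) :
    HasDerivAt (fun t : ℝ => (x + t • EuclideanSpace.single i (1 : ℝ)) a)
      (if a = i then 1 else 0) 0 := by
  have h : (fun t : ℝ => (x + t • EuclideanSpace.single i (1 : ℝ)) a)
      = fun t : ℝ => x a + t * (if a = i then 1 else 0) := by
    ext t
    simp
  rw [h]
  simpa using ((hasDerivAt_id (0 : ℝ)).mul_const (if a = i then (1 : ℝ) else 0)).const_add (x a)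

lemma norm_sq_coords (x : E3) : ‖x‖ ^ 2 = x 0 ^ 2 + x 1 ^ 2 + x 2 ^ 2 := by
  rw [EuclideanSpace.real_norm_sq_eq, Fin.sum_univ_three]

lemma hasDerivAt_line_norm {x : E3} (hx : x ≠ 0) (i : Fin 3) :
    HasDerivAt (fun t : ℝ => ‖x + t • EuclideanSpace.single i (1 : ℝ)‖) (x i / ‖x‖) 0 := by
  have hn : 0 < ‖x‖ := norm_pos_iff.2 hx
  have h0 : (fun t : ℝ => ‖x + t • EuclideanSpace.single i (1 : ℝ)‖) = fun t : ℝ =>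
      √(∑ a, (x + t • EuclideanSpace.single i (1 : ℝ)) a ^ 2) := by
    ext t
    rw [← EuclideanSpace.real_norm_sq_eq, Real.sqrt_sq (norm_nonneg _)]
  have h1 : HasDerivAt (fun t : ℝ => ∑ a, (x + t • EuclideanSpace.single i (1 : ℝ)) a ^ 2)
      (2 * x i) 0 := by
    have := HasDerivAt.fun_sum (u := Finset.univ) fun a _ => (hasDerivAt_line_apply x i a).pow 2
    convert! this using 1
    simp
  have h2 : (∑ a, (x + (0 : ℝ) • EuclideanSpace.single i (1 : ℝ)) a ^ 2) = ‖x‖ ^ 2 := by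
    rw [zero_smul, add_zero, EuclideanSpace.real_norm_sq_eq]
  rw [h0]
  convert! h1.sqrt (by rw [h2]; positivity) using 1
  rw [h2, Real.sqrt_sq hn.le]
  field_simp

lemma hasDerivAt_line_norm_pow_inv {x : E3} (hx : x ≠ 0) (i : Fin 3) (n : ℕ) :
    HasDerivAt (fun t : ℝ => (‖x + t • EuclideanSpace.single i (1 : ℝ)‖ ^ n)⁻¹)
      (-(n * x i) / ‖x‖ ^ (n + 2)) 0 := by
  have hn : 0 < ‖x‖ := norm_pos_iff.2 hx
  have := ((hasDerivAt_line_norm hx i).fun_pow n).inv (by simp [hn.ne'])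
  convert! this using 1
  simp only [zero_smul, add_zero]
  rcases n with _ | n
  · simp
  · simp only [Nat.add_sub_cancel]
    field_simp
    ring

lemma pd3_newton {z : E3} (hz : z ≠ 0) (a : Fin 3) :
    pd3 newton a z = 1 / (4 * π) * (-(z a) * (‖z‖ ^ 3)⁻¹) := by
  refine pd3_eq_of_hasLineDerivAt (homKernel_newton.differentiableAt hz) ?_
  have := (hasDerivAt_line_norm_pow_inv hz a 1).const_mul (1 / (4 * π))
  convert! this using 1
  · ext t
    simp [newton]
    ring
  · simp
    ring

lemma pd3_pd3_newton {z : E3} (hz : z ≠ 0) (a b : Fin 3) :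
    pd3 (pd3 newton a) b z = 1 / (4 * π) *
      (3 * (z a * z b * (‖z‖ ^ 5)⁻¹) - (if a = b then 1 else 0) * (‖z‖ ^ 3)⁻¹) := by
  have hev : pd3 newton a =ᶠ[𝓝 z] fun w => 1 / (4 * π) * (-(w a) * (‖w‖ ^ 3)⁻¹) := by
    filter_upwards [isOpen_compl_singleton.mem_nhds hz] with w hw using pd3_newton hw a
  have hd := (homKernel_newton.pd3 a).differentiableAt hz
  have h := pd3_eq_of_hasLineDerivAt (i := b) (hd.congr_of_eventuallyEq hev.symm)
    (((hasDerivAt_line_apply z b a).neg.mul (hasDerivAt_line_norm_pow_inv hz b 3)).const_mul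
      (1 / (4 * π)))
  rw [pd3, hev.fderiv_eq]
  refine h.trans ?_
  have hn : 0 < ‖z‖ := norm_pos_iff.2 hz
  simp only [zero_smul, add_zero, Pi.neg_apply]
  field_simp
  push_cast
  ring

lemma pd3_pd3_pd3_newton {z : E3} (hz : z ≠ 0) (a b c : Fin 3) :
    pd3 (pd3 (pd3 newton a) b) c z = 1 / (4 * π) *
      (3 * (((if a = c then 1 else 0) * z b + z a * (if b = c then 1 else 0)) * (‖z‖ ^ 5)⁻¹)
        - 15 * (z a * z b * z c * (‖z‖ ^ 7)⁻¹)
        + (if a = b then 1 else 0) * (3 * z c * (‖z‖ ^ 5)⁻¹)) := by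
  have hev : pd3 (pd3 newton a) b =ᶠ[𝓝 z] fun w => 1 / (4 * π) *
      (3 * (w a * w b * (‖w‖ ^ 5)⁻¹) - (if a = b then 1 else 0) * (‖w‖ ^ 3)⁻¹) := by
    filter_upwards [isOpen_compl_singleton.mem_nhds hz] with w hw using pd3_pd3_newton hw a b
  have hd := ((homKernel_newton.pd3 a).pd3 b).differentiableAt hz
  have h := pd3_eq_of_hasLineDerivAt (i := c) (hd.congr_of_eventuallyEq hev.symm)
    ((((((hasDerivAt_line_apply z c a).mul (hasDerivAt_line_apply z c b)).mul
      (hasDerivAt_line_norm_pow_inv hz c 5)).const_mul 3).sub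
      ((hasDerivAt_line_norm_pow_inv hz c 3).const_mul _)).const_mul (1 / (4 * π)))
  rw [pd3, hev.fderiv_eq]
  refine h.trans ?_
  have hn : 0 < ‖z‖ := norm_pos_iff.2 hz
  simp only [zero_smul, add_zero, Pi.mul_apply]
  field_simp
  push_cast
  ring

lemma e3_apply_zero (a b c : ℝ) : e3 a b c 0 = a := rfl
lemma e3_apply_one (a b c : ℝ) : e3 a b c 1 = b := rfl
lemma e3_apply_two (a b c : ℝ) : e3 a b c 2 = c := rfl

lemma norm_e3_axis (t : ℝ) : ‖e3 t 0 0‖ = |t| := by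
  rw [← sq_eq_sq₀ (norm_nonneg _) (abs_nonneg _), norm_sq_coords]
  simp [e3_apply_zero, e3_apply_one, e3_apply_two]

/-- The leading coefficient on the axis of symmetry. -/
lemma sum_pd3_newton_axis {t : ℝ} (ht : t ≠ 0) (M : Fin 3 → Fin 3 → ℝ) :
    ∑ i, ∑ j, pd3 (pd3 (pd3 newton 0) i) j (e3 t 0 0) * M i j
      = 3 / (4 * π) * (M 1 1 + M 2 2 - 2 * M 0 0) * (t / |t| ^ 5) := by
  have hz : e3 t 0 0 ≠ 0 := norm_pos_iff.1 (by rw [norm_e3_axis]; exact abs_pos.2 ht)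
  have hn : 0 < |t| := abs_pos.2 ht
  simp only [pd3_pd3_pd3_newton hz, Fin.sum_univ_three, e3_apply_zero, e3_apply_one,
    e3_apply_two, norm_e3_axis]
  simp
  have h2 : t ^ 2 = |t| ^ 2 := (sq_abs t).symm
  have h3 : t * t * t * (|t| ^ 7)⁻¹ = t * (|t| ^ 5)⁻¹ := by
    field_simp
    linear_combination h2
  rw [h3]
  field_simp
  ring

section Potential
open scoped Convolution

lemma integrable_kernel_mul_of_locallyIntegrable {k g : E3 → ℝ} (hk : LocallyIntegrable k)
    (hg : TestFn g) (x : E3) : Integrable (fun y => k (x - y) * g y) := by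
  have := (hg.compact.convolutionExists_right (ContinuousLinearMap.lsmul ℝ ℝ) hk
    hg.smooth.continuous x).integrable_swap
  simpa using this

end Potential

/-- The Newtonian potential of `∑ ∂ᵢ∂ⱼ Sᵢⱼ`. -/
def quadPot (S : Fin 3 → Fin 3 → E3 → ℝ) (x : E3) : ℝ :=
  ∑ i, ∑ j, kpot newton (pd3 (pd3 (S i j) j) i) x

lemma contDiff_quadPot {S : Fin 3 → Fin 3 → E3 → ℝ} (hS : ∀ i j, TestFn (S i j)) :
    ContDiff ℝ (⊤ : ℕ∞) (quadPot S) := by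
  unfold quadPot
  exact ContDiff.sum fun i _ => ContDiff.sum fun j _ =>
    contDiff_kpot locallyIntegrable_newton (((hS i j).pd3 j).pd3 i)

lemma pd3_sum_sum {g : Fin 3 → Fin 3 → E3 → ℝ} (hg : ∀ i j, ContDiff ℝ (⊤ : ℕ∞) (g i j))
    (l : Fin 3) : pd3 (fun x => ∑ i, ∑ j, g i j x) l = fun x => ∑ i, ∑ j, pd3 (g i j) l x := by
  ext x
  have hd : ∀ i j, HasFDerivAt (g i j) (fderiv ℝ (g i j) x) x := fun i j =>
    ((hg i j).differentiable (by simp) x).hasFDerivAt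
  have := HasFDerivAt.fun_sum (u := Finset.univ) fun i _ =>
    HasFDerivAt.fun_sum (u := Finset.univ) fun j _ => hd i j
  rw [pd3, this.fderiv]
  simp [pd3]

lemma pd3_quadPot {S : Fin 3 → Fin 3 → E3 → ℝ} (hS : ∀ i j, TestFn (S i j)) (l : Fin 3) :
    pd3 (quadPot S) l = fun x => ∑ i, ∑ j, kpot newton (pd3 (pd3 (pd3 (S i j) j) i) l) x := by
  have h := pd3_sum_sum (fun i j => contDiff_kpot locallyIntegrable_newton
    (((hS i j).pd3 j).pd3 i)) l
  refine Eq.trans h ?_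
  ext x
  simp only [pd3_kpot locallyIntegrable_newton (((hS _ _).pd3 _).pd3 _)]

lemma pd3_pd3_quadPot {S : Fin 3 → Fin 3 → E3 → ℝ} (hS : ∀ i j, TestFn (S i j)) (l m : Fin 3) :
    pd3 (pd3 (quadPot S) l) m =
      fun x => ∑ i, ∑ j, kpot newton (pd3 (pd3 (pd3 (pd3 (S i j) j) i) l) m) x := by
  have h := pd3_sum_sum (fun i j => contDiff_kpot locallyIntegrable_newton
    ((((hS i j).pd3 j).pd3 i).pd3 l)) m
  rw [pd3_quadPot hS]
  refine Eq.trans h ?_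
  ext x
  simp only [pd3_kpot locallyIntegrable_newton ((((hS _ _).pd3 _).pd3 _).pd3 _)]

lemma kpot_pd3_pd3_pd3 {m : ℕ} {k g : E3 → ℝ} {x : E3} (hk : HomKernel m k) (hg : TestFn g)
    (hx : x ∉ tsupport g) (i j l : Fin 3) :
    kpot k (pd3 (pd3 (pd3 g j) i) l) x = kpot (pd3 (pd3 (pd3 k l) i) j) g x := by
  have hx1 : x ∉ tsupport (pd3 g j) := fun h => hx (tsupport_pd3_subset _ _ h)
  have hx2 : x ∉ tsupport (pd3 (pd3 g j) i) := fun h => hx1 (tsupport_pd3_subset _ _ h)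
  rw [kpot_pd3 hk ((hg.pd3 j).pd3 i) hx2, kpot_pd3 (hk.pd3 l) (hg.pd3 j) hx1,
    kpot_pd3 ((hk.pd3 l).pd3 i) hg hx]

lemma exists_bound_sum {n : ℕ} {g h : Fin 3 → Fin 3 → E3 → ℝ}
    (H : ∀ i j, ∃ C R : ℝ, ∀ x, R < ‖x‖ → |g i j x - h i j x| ≤ C / ‖x‖ ^ n) :
    ∃ C R : ℝ, ∀ x, R < ‖x‖ →
      |∑ i, ∑ j, g i j x - ∑ i, ∑ j, h i j x| ≤ C / ‖x‖ ^ n := by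
  choose C R hCR using H
  refine ⟨∑ i, ∑ j, C i j, ∑ i, ∑ j, |R i j|, fun x hx => ?_⟩
  simp only [← Finset.sum_sub_distrib, Finset.sum_div]
  refine (Finset.abs_sum_le_sum_abs _ _).trans (Finset.sum_le_sum fun i _ => ?_)
  refine (Finset.abs_sum_le_sum_abs _ _).trans (Finset.sum_le_sum fun j _ => ?_)
  refine hCR i j x (lt_of_le_of_lt (le_abs_self _) (lt_of_le_of_lt ?_ hx))
  exact (Finset.single_le_sum (f := fun j => |R i j|) (fun _ _ => abs_nonneg _)
    (Finset.mem_univ j)).trans (Finset.single_le_sum (f := fun i => ∑ j, |R i j|)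
    (fun _ _ => Finset.sum_nonneg fun _ _ => abs_nonneg _) (Finset.mem_univ i))

lemma exists_bound_of_far {n : ℕ} {g : E3 → ℝ} (hg : Continuous g)
    (H : ∃ C R : ℝ, ∀ x, R < ‖x‖ → |g x| ≤ C / ‖x‖ ^ n) :
    ∃ C : ℝ, 0 < C ∧ ∀ x, x ≠ 0 → |g x| ≤ C / ‖x‖ ^ n := by
  obtain ⟨C, R, hC⟩ := H
  obtain ⟨K, hK⟩ := (isCompact_closedBall (0 : E3) R).exists_bound_of_continuousOn hg.continuousOn
  refine ⟨max 1 (max C (K * R ^ n)), by positivity, fun x hx => ?_⟩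
  have hn : 0 < ‖x‖ := norm_pos_iff.2 hx
  by_cases h : R < ‖x‖
  · refine (hC x h).trans ?_
    gcongr
    exact (le_max_left _ _).trans (le_max_right _ _)
  · push Not at h
    have h1 := hK x (by simpa using h)
    rw [Real.norm_eq_abs] at h1
    rw [le_div_iff₀ (by positivity)]
    refine le_trans ?_ ((le_max_right _ _).trans (le_max_right _ _))
    have h0 : 0 ≤ K := (abs_nonneg _).trans h1
    gcongr

lemma pd3_quadPot_leading {S : Fin 3 → Fin 3 → E3 → ℝ} (hS : ∀ i j, TestFn (S i j)) (l : Fin 3) :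
    ∃ C R : ℝ, ∀ x, R < ‖x‖ →
      |pd3 (quadPot S) l x - ∑ i, ∑ j, pd3 (pd3 (pd3 newton l) i) j x * ∫ y, S i j y|
        ≤ C / ‖x‖ ^ 5 := by
  rw [pd3_quadPot hS]
  refine exists_bound_sum fun i j => ?_
  obtain ⟨C, R, hC⟩ := kpot_leading (((homKernel_newton.pd3 l).pd3 i).pd3 j) (hS i j)
  obtain ⟨R', _, hR'⟩ := (hS i j).exists_tsupport_subset
  refine ⟨C, max R R', fun x hx => ?_⟩
  rw [kpot_pd3_pd3_pd3 homKernel_newton (hS i j)]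
  · exact hC x (lt_of_le_of_lt (le_max_left _ _) hx)
  · intro h
    have h2 := hR' h
    simp only [mem_closedBall_zero_iff] at h2
    exact absurd (lt_of_le_of_lt (le_max_right _ _) hx) (not_lt.2 h2)

lemma pd3_quadPot_bound {S : Fin 3 → Fin 3 → E3 → ℝ} (hS : ∀ i j, TestFn (S i j)) (l : Fin 3) :
    ∃ C : ℝ, 0 < C ∧ ∀ x, x ≠ 0 → |pd3 (quadPot S) l x| ≤ C / ‖x‖ ^ 4 := by
  refine exists_bound_of_far (contDiff_pd3 (contDiff_quadPot hS) l).continuous ?_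
  have := exists_bound_sum (n := 4)
    (g := fun i j x => kpot newton (pd3 (pd3 (pd3 (S i j) j) i) l) x) (h := fun _ _ _ => 0) ?_
  · rw [pd3_quadPot hS]
    simpa using this
  intro i j
  obtain ⟨C, R, hC⟩ := kpot_bound (((homKernel_newton.pd3 l).pd3 i).pd3 j) (hS i j)
  obtain ⟨R', _, hR'⟩ := (hS i j).exists_tsupport_subset
  refine ⟨C, max R R', fun x hx => ?_⟩
  rw [kpot_pd3_pd3_pd3 homKernel_newton (hS i j), sub_zero]
  · exact hC x (lt_of_le_of_lt (le_max_left _ _) hx)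
  · intro h
    have h2 := hR' h
    simp only [mem_closedBall_zero_iff] at h2
    exact absurd (lt_of_le_of_lt (le_max_right _ _) hx) (not_lt.2 h2)

lemma pd3_pd3_quadPot_bound {S : Fin 3 → Fin 3 → E3 → ℝ} (hS : ∀ i j, TestFn (S i j))
    (l m : Fin 3) :
    ∃ C : ℝ, 0 < C ∧ ∀ x, x ≠ 0 → |pd3 (pd3 (quadPot S) l) m x| ≤ C / ‖x‖ ^ 5 := by
  refine exists_bound_of_far (contDiff_pd3 (contDiff_pd3 (contDiff_quadPot hS) l) m).continuous ?_
  have := exists_bound_sum (n := 5)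
    (g := fun i j x => kpot newton (pd3 (pd3 (pd3 (pd3 (S i j) j) i) l) m) x)
    (h := fun _ _ _ => 0) ?_
  · rw [pd3_pd3_quadPot hS]
    simpa using this
  intro i j
  obtain ⟨C, R, hC⟩ := kpot_bound ((((homKernel_newton.pd3 m).pd3 l).pd3 i).pd3 j) (hS i j)
  obtain ⟨R', _, hR'⟩ := (hS i j).exists_tsupport_subset
  refine ⟨C, max R R', fun x hx => ?_⟩
  have hxs : x ∉ tsupport (S i j) := by
    intro h
    have h2 := hR' h
    simp only [mem_closedBall_zero_iff] at h2
    exact absurd (lt_of_le_of_lt (le_max_right _ _) hx) (not_lt.2 h2)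
  rw [kpot_pd3 homKernel_newton (((hS i j).pd3 j).pd3 i |>.pd3 l) (fun h => hxs
      (tsupport_pd3_subset _ _ (tsupport_pd3_subset _ _ (tsupport_pd3_subset _ _ h)))),
    kpot_pd3_pd3_pd3 (homKernel_newton.pd3 m) (hS i j) hxs, sub_zero]
  exact hC x (lt_of_le_of_lt (le_max_left _ _) hx)

lemma rad_nonneg (x : E3) : 0 ≤ rad x := Real.sqrt_nonneg _

lemma rad_sq (x : E3) : rad x ^ 2 = x 1 ^ 2 + x 2 ^ 2 := Real.sq_sqrt (by positivity)

lemma continuous_rad : Continuous rad := by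
  unfold rad
  fun_prop

lemma continuous_Rinv : Continuous Rinv := by
  unfold Rinv
  exact Continuous.prodMk (by fun_prop) continuous_rad

lemma contDiffAt_coord (i : Fin 3) (x : E3) : ContDiffAt ℝ (⊤ : ℕ∞) (fun y : E3 => y i) x :=
  (EuclideanSpace.proj (𝕜 := ℝ) i).contDiff.contDiffAt

lemma contDiffAt_rad {x : E3} (hx : 0 < rad x) : ContDiffAt ℝ (⊤ : ℕ∞) rad x := by
  refine ContDiffAt.sqrt (((contDiffAt_coord 1 x).pow 2).add ((contDiffAt_coord 2 x).pow 2)) ?_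
  rw [← rad_sq]
  positivity

lemma contDiffAt_Rinv {x : E3} (hx : 0 < rad x) : ContDiffAt ℝ (⊤ : ℕ∞) Rinv x :=
  (contDiffAt_coord 0 x).prodMk (contDiffAt_rad hx)

lemma norm_le_of_Rinv {x : E3} {R : ℝ} (h : ‖Rinv x‖ ≤ R) : ‖x‖ ≤ 2 * R := by
  have h1 : |x 0| ≤ R := (norm_fst_le (Rinv x)).trans h
  have h2 : |rad x| ≤ R := (norm_snd_le (Rinv x)).trans h
  have hR : 0 ≤ R := (abs_nonneg _).trans h1
  refine abs_le_of_sq_le_sq' ?_ (by positivity) |>.2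
  rw [norm_sq_coords, add_assoc, ← rad_sq, ← sq_abs (x 0), ← sq_abs (rad x)]
  nlinarith [abs_nonneg (x 0), abs_nonneg (rad x)]

/-- A smooth profile supported in the open half-plane is zero near any point whose projection
is off its support. -/
lemma eventually_eq_zero_of_Rinv {g : Pt → ℝ} {x : E3} (hx : Rinv x ∉ tsupport g) :
    ∀ᶠ y in 𝓝 x, g (Rinv y) = 0 := by
  have : Rinv ⁻¹' (tsupport g)ᶜ ∈ 𝓝 x :=
    ((isClosed_tsupport g).isOpen_compl.preimage continuous_Rinv).mem_nhds hx
  filter_upwards [this] with y hy using image_eq_zero_of_notMem_tsupport hy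

lemma testFn_lift {g : Pt → ℝ} {h : E3 → ℝ} (hg : SmoothCompSuppP g)
    (hh : ∀ x, 0 < rad x → ContDiffAt ℝ (⊤ : ℕ∞) h x) : TestFn (fun x => g (Rinv x) * h x) := by
  constructor
  · rw [contDiff_iff_contDiffAt]
    intro x
    by_cases hx : Rinv x ∈ tsupport g
    · have hr : 0 < rad x := hg.2.2 hx
      exact (hg.1.contDiffAt.comp x (contDiffAt_Rinv hr)).mul (hh x hr)
    · refine (contDiffAt_const (c := (0 : ℝ))).congr_of_eventuallyEq ?_
      filter_upwards [eventually_eq_zero_of_Rinv hx] with y hy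
      simp [hy]
  · obtain ⟨R, hR⟩ := hg.2.1.isBounded.subset_closedBall 0
    refine HasCompactSupport.intro (isCompact_closedBall (0 : E3) (2 * R)) fun x hx => ?_
    have : Rinv x ∉ tsupport g := fun h => hx (by
      have := hR h
      rw [mem_closedBall_zero_iff] at this ⊢
      exact norm_le_of_Rinv this)
    simp [image_eq_zero_of_notMem_tsupport this]

/-- Profiles `(v, f)` generating a smooth divergence-free axisymmetric field. -/
structure FlowProfile (v₁ v₂ f : Pt → ℝ) : Prop where
  fst : SmoothCompSuppP v₁
  snd : SmoothCompSuppP v₂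
  swirl : SmoothCompSuppP (wcomp v₁ v₂ f)
  div : ∀ p, div2w v₁ v₂ p = 0
  le : ∀ p, v₁ p ^ 2 + v₂ p ^ 2 ≤ f p ^ 2

lemma uvf_zero (v₁ v₂ f : Pt → ℝ) (x : E3) : uvf v₁ v₂ f x 0 = v₁ (Rinv x) := rfl

lemma uvf_one (v₁ v₂ f : Pt → ℝ) (x : E3) : uvf v₁ v₂ f x 1 =
    v₂ (Rinv x) * (x 1 / rad x) - wcomp v₁ v₂ f (Rinv x) * (x 2 / rad x) := rfl

lemma uvf_two (v₁ v₂ f : Pt → ℝ) (x : E3) : uvf v₁ v₂ f x 2 =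
    v₂ (Rinv x) * (x 2 / rad x) + wcomp v₁ v₂ f (Rinv x) * (x 1 / rad x) := rfl

lemma contDiffAt_coord_div_rad (i : Fin 3) (x : E3) (hx : 0 < rad x) :
    ContDiffAt ℝ (⊤ : ℕ∞) (fun y : E3 => y i / rad y) x :=
  (contDiffAt_coord i x).div (contDiffAt_rad hx) hx.ne'

lemma FlowProfile.testFn {v₁ v₂ f : Pt → ℝ} (h : FlowProfile v₁ v₂ f) (i : Fin 3) :
    TestFn (fun x => uvf v₁ v₂ f x i) := by
  fin_cases i
  · simpa [uvf_zero] using testFn_lift (h := fun _ => 1) h.fst (fun _ _ => contDiffAt_const)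
  · exact (testFn_lift h.snd (contDiffAt_coord_div_rad 1)).sub
      (testFn_lift h.swirl (contDiffAt_coord_div_rad 2))
  · exact (testFn_lift h.snd (contDiffAt_coord_div_rad 2)).add
      (testFn_lift h.swirl (contDiffAt_coord_div_rad 1))

lemma hasDerivAt_line_rad {x : E3} (hx : 0 < rad x) (i : Fin 3) :
    HasDerivAt (fun t : ℝ => rad (x + t • EuclideanSpace.single i (1 : ℝ)))
      ((x 1 * (if 1 = i then 1 else 0) + x 2 * (if 2 = i then 1 else 0)) / rad x) 0 := by
  have h := ((hasDerivAt_line_apply x i 1).fun_pow 2).fun_add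
    ((hasDerivAt_line_apply x i 2).fun_pow 2)
  have h2 := h.sqrt (by simp only [zero_smul, add_zero, ← rad_sq]; positivity)
  convert! h2 using 1
  simp only [zero_smul, add_zero, ← rad_sq, Real.sqrt_sq hx.le]
  field_simp
  push_cast
  ring

lemma fderiv_eq_pdx_pdy (g : Pt → ℝ) (p : Pt) (a b : ℝ) :
    fderiv ℝ g p (a, b) = a * pdx g p + b * pdy g p := by
  have : ((a, b) : Pt) = a • ((1 : ℝ), (0 : ℝ)) + b • ((0 : ℝ), (1 : ℝ)) := by simp
  rw [this, map_add, map_smul, map_smul]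
  rfl

lemma hasDerivAt_line_lift {g : Pt → ℝ} (hg : ContDiff ℝ (⊤ : ℕ∞) g) {x : E3} (hx : 0 < rad x)
    (i : Fin 3) :
    HasDerivAt (fun t : ℝ => g (Rinv (x + t • EuclideanSpace.single i (1 : ℝ))))
      ((if 0 = i then 1 else 0) * pdx g (Rinv x) +
        (x 1 * (if 1 = i then 1 else 0) + x 2 * (if 2 = i then 1 else 0)) / rad x
          * pdy g (Rinv x)) 0 := by
  have h1 := (hasDerivAt_line_apply x i 0).prodMk (hasDerivAt_line_rad hx i)
  have h2 := ((hg.differentiable (by simp) (Rinv (x + (0 : ℝ) •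
    EuclideanSpace.single i (1 : ℝ)))).hasFDerivAt).comp_hasDerivAt 0 h1
  convert! h2 using 1
  rw [← fderiv_eq_pdx_pdy, zero_smul, add_zero]

lemma pd3_lift_mul_coord {g : Pt → ℝ} (hg : SmoothCompSuppP g) {x : E3} (hx : 0 < rad x)
    (a i : Fin 3) : pd3 (fun y => g (Rinv y) * (y a / rad y)) i x =
      ((if 0 = i then 1 else 0) * pdx g (Rinv x) +
        (x 1 * (if 1 = i then 1 else 0) + x 2 * (if 2 = i then 1 else 0)) / rad x
          * pdy g (Rinv x)) * (x a / rad x) + g (Rinv x) * (((if a = i then 1 else 0) * rad x - x a *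
            ((x 1 * (if 1 = i then 1 else 0) + x 2 * (if 2 = i then 1 else 0)) / rad x))
              / rad x ^ 2) := by
  refine pd3_eq_of_hasLineDerivAt
    ((testFn_lift hg (contDiffAt_coord_div_rad a)).smooth.differentiable (by simp) x) ?_
  have := (hasDerivAt_line_lift hg.1 hx i).mul ((hasDerivAt_line_apply x i a).div
    (hasDerivAt_line_rad hx i) (by simpa using hx.ne'))
  convert! this using 1
  simp

lemma pd3_fun_add {g h : E3 → ℝ} (hg : TestFn g) (hh : TestFn h) (i : Fin 3) (x : E3) :
    pd3 (fun y => g y + h y) i x = pd3 g i x + pd3 h i x := by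
  rw [pd3, fderiv_fun_add (hg.smooth.differentiable (by simp) x)
    (hh.smooth.differentiable (by simp) x)]
  rfl

lemma pd3_fun_sub {g h : E3 → ℝ} (hg : TestFn g) (hh : TestFn h) (i : Fin 3) (x : E3) :
    pd3 (fun y => g y - h y) i x = pd3 g i x - pd3 h i x := by
  rw [pd3, fderiv_fun_sub (hg.smooth.differentiable (by simp) x)
    (hh.smooth.differentiable (by simp) x)]
  rfl

lemma pd3_fun_mul {g h : E3 → ℝ} (hg : TestFn g) (hh : TestFn h) (i : Fin 3) :
    pd3 (fun y => g y * h y) i = fun x => pd3 g i x * h x + g x * pd3 h i x := by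
  ext x
  rw [pd3, fderiv_fun_mul (hg.smooth.differentiable (by simp) x)
    (hh.smooth.differentiable (by simp) x)]
  simp [pd3]
  ring

lemma pd3_comm {g : E3 → ℝ} (hg : TestFn g) (i j : Fin 3) (x : E3) :
    pd3 (pd3 g i) j x = pd3 (pd3 g j) i x := by
  have hd : DifferentiableAt ℝ (fderiv ℝ g) x :=
    (hg.smooth.fderiv_right (m := 1) (by norm_cast)).differentiable (by simp) x
  have key : ∀ a b : Fin 3, pd3 (pd3 g a) b x =
      fderiv ℝ (fderiv ℝ g) x (EuclideanSpace.single b 1) (EuclideanSpace.single a 1) := by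
    intro a b
    have := (hd.hasFDerivAt.clm_apply (hasFDerivAt_const (EuclideanSpace.single a (1 : ℝ)) x)).fderiv
    change fderiv ℝ (fun y => fderiv ℝ g y (EuclideanSpace.single a 1)) x _ = _
    rw [this]
    simp
  rw [key, key]
  exact (hg.smooth.contDiffAt.isSymmSndFDerivAt
    (by simp; exact WithTop.coe_le_coe.2 (le_top : (2 : ℕ∞) ≤ ⊤))).eq _ _

lemma div2w_eq {v₁ v₂ : Pt → ℝ} (h₁ : ContDiff ℝ (⊤ : ℕ∞) v₁) (h₂ : ContDiff ℝ (⊤ : ℕ∞) v₂)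
    (p : Pt) : div2w v₁ v₂ p = p.2 * pdx v₁ p + v₂ p + p.2 * pdy v₂ p := by
  have d₁ := h₁.differentiable (by simp) p
  have d₂ := h₂.differentiable (by simp) p
  have hs : HasFDerivAt (fun q : Pt => q.2) (ContinuousLinearMap.snd ℝ ℝ ℝ) p := hasFDerivAt_snd
  have e₁ := (hs.mul d₁.hasFDerivAt).fderiv
  have e₂ := (hs.mul d₂.hasFDerivAt).fderiv
  simp only [div2w, pdx, pdy] at *
  have e₁' : fderiv ℝ (fun q : Pt => q.2 * v₁ q) p = _ := e₁
  have e₂' : fderiv ℝ (fun q : Pt => q.2 * v₂ q) p = _ := e₂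
  rw [e₁', e₂']
  simp
  ring

lemma pd3_eq_zero_of_eventually {g : E3 → ℝ} {x : E3} (h : ∀ᶠ y in 𝓝 x, g y = 0) (i : Fin 3) :
    pd3 g i x = 0 := by
  have h' : g =ᶠ[𝓝 x] fun _ => (0 : ℝ) := h
  rw [pd3, h'.fderiv_eq]
  simp

lemma FlowProfile.div3_uvf {v₁ v₂ f : Pt → ℝ} (h : FlowProfile v₁ v₂ f) (x : E3) :
    div3 (uvf v₁ v₂ f) x = 0 := by
  by_cases hx : 0 < rad x
  · have h0 : pd3 (fun y => uvf v₁ v₂ f y 0) 0 x = pdx v₁ (Rinv x) := by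
      refine (pd3_eq_of_hasLineDerivAt ((h.testFn 0).smooth.differentiable (by simp) x)
        (hasDerivAt_line_lift h.fst.1 hx 0)).trans ?_
      simp
    have h1 : pd3 (fun y => uvf v₁ v₂ f y 1) 1 x = _ :=
      pd3_fun_sub (testFn_lift h.snd (contDiffAt_coord_div_rad 1))
        (testFn_lift h.swirl (contDiffAt_coord_div_rad 2)) 1 x
    have h2 : pd3 (fun y => uvf v₁ v₂ f y 2) 2 x = _ :=
      pd3_fun_add (testFn_lift h.snd (contDiffAt_coord_div_rad 2))
        (testFn_lift h.swirl (contDiffAt_coord_div_rad 1)) 2 x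
    rw [div3, Fin.sum_univ_three, h0, h1, h2, pd3_lift_mul_coord h.snd hx,
      pd3_lift_mul_coord h.snd hx, pd3_lift_mul_coord h.swirl hx, pd3_lift_mul_coord h.swirl hx]
    have hd := h.div (Rinv x)
    rw [div2w_eq h.fst.1 h.snd.1] at hd
    change rad x * _ + _ + rad x * _ = 0 at hd
    have hr := rad_sq x
    simp
    field_simp
    linear_combination (rad x) ^ 2 * hd -
      (pdy v₂ (Rinv x) * rad x - v₂ (Rinv x)) * hr
  · have hz : rad x = 0 := le_antisymm (not_lt.1 hx) (rad_nonneg x)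
    have key : ∀ {g : Pt → ℝ}, SmoothCompSuppP g → ∀ᶠ y in 𝓝 x, g (Rinv y) = 0 := fun hg =>
      eventually_eq_zero_of_Rinv fun hm => hx (hg.2.2 hm)
    rw [div3]
    refine Finset.sum_eq_zero fun i _ => pd3_eq_zero_of_eventually ?_ i
    filter_upwards [key h.fst, key h.snd, key h.swirl] with y h0 h1 h2
    fin_cases i
    · simp [uvf_zero, h0]
    · simp [uvf_one, h1, h2]
    · simp [uvf_two, h1, h2]

lemma sum_pd3_mul_pd3_eq {u : E3 → E3} (hu : ∀ i, TestFn (fun x => u x i))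
    (hdiv : ∀ x, div3 u x = 0) (x : E3) :
    ∑ i, ∑ j, pd3 (fun z => u z j) i x * pd3 (fun z => u z i) j x =
      ∑ i, ∑ j, pd3 (pd3 (fun y => u y i * u y j) j) i x := by
  have hT : ∀ i j, pd3 (pd3 (fun y => u y i * u y j) j) i x =
      (pd3 (pd3 (fun y => u y i) i) j x * u x j + pd3 (fun y => u y i) j x * pd3 (fun y => u y j) i x)
      + (pd3 (fun y => u y i) i x * pd3 (fun y => u y j) j x
        + u x i * pd3 (pd3 (fun y => u y j) j) i x) := by
    intro i j
    rw [pd3_fun_mul (hu i) (hu j), pd3_fun_add (((hu i).pd3 j).mul (hu j))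
      ((hu i).mul ((hu j).pd3 j)), pd3_fun_mul ((hu i).pd3 j) (hu j),
      pd3_fun_mul (hu i) ((hu j).pd3 j)]
    beta_reduce
    rw [pd3_comm (hu i) j i]
  have hD : ∑ i, pd3 (fun y => u y i) i x = 0 := hdiv x
  have hE : ∀ l, ∑ i, pd3 (pd3 (fun y => u y i) i) l x = 0 := by
    intro l
    have h1 : pd3 (div3 u) l x = 0 :=
      pd3_eq_zero_of_eventually (.of_forall hdiv) l
    have h2 : pd3 (div3 u) l x = ∑ i, pd3 (pd3 (fun y => u y i) i) l x := by
      have := HasFDerivAt.fun_sum (u := Finset.univ) (x := x) fun i _ =>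
        (((hu i).pd3 i).smooth.differentiable (by simp) x).hasFDerivAt
      have e : div3 u = fun y => ∑ i, pd3 (fun y => u y i) i y := rfl
      rw [pd3, e, this.fderiv]
      simp [pd3]
    rw [← h2, h1]
  simp only [hT]
  have hE0 := hE 0
  have hE1 := hE 1
  have hE2 := hE 2
  simp only [Fin.sum_univ_three] at *
  linear_combination -(2 * u x 0) * hE0 - (2 * u x 1) * hE1 - (2 * u x 2) * hE2 -
    (pd3 (fun y => u y 0) 0 x + pd3 (fun y => u y 1) 1 x + pd3 (fun y => u y 2) 2 x) * hD

lemma pressureFn_eq_kpot (u : E3 → E3) : pressureFn u =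
    kpot newton (fun y => ∑ i, ∑ j, pd3 (fun z => u z j) i y * pd3 (fun z => u z i) j y) := by
  ext x
  rw [pressureFn, kpot]
  congr 1
  ext y
  rw [newton]
  ring

lemma kpot_sum_sum {g : Fin 3 → Fin 3 → E3 → ℝ} (hg : ∀ i j, TestFn (g i j)) (x : E3) :
    kpot newton (fun y => ∑ i, ∑ j, g i j y) x = ∑ i, ∑ j, kpot newton (g i j) x := by
  have hi := fun i j => integrable_kernel_mul_of_locallyIntegrable locallyIntegrable_newton
    (hg i j) x
  simp only [kpot, Finset.mul_sum]
  rw [integral_finsetSum _ fun i _ => integrable_finsetSum _ fun j _ => hi i j]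
  refine Finset.sum_congr rfl fun i _ => ?_
  rw [integral_finsetSum _ fun j _ => hi i j]

lemma FlowProfile.pressureFn_eq {v₁ v₂ f : Pt → ℝ} (h : FlowProfile v₁ v₂ f) :
    pressureFn (uvf v₁ v₂ f) = quadPot (fun i j x => uvf v₁ v₂ f x i * uvf v₁ v₂ f x j) := by
  ext x
  rw [pressureFn_eq_kpot]
  simp only [sum_pd3_mul_pd3_eq h.testFn h.div3_uvf]
  exact kpot_sum_sum (fun i j => (((h.testFn i).mul (h.testFn j)).pd3 j).pd3 i) x

lemma quadPot_sub {S T : Fin 3 → Fin 3 → E3 → ℝ} (hS : ∀ i j, TestFn (S i j))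
    (hT : ∀ i j, TestFn (T i j)) (x : E3) :
    quadPot (fun i j x => S i j x - T i j x) x = quadPot S x - quadPot T x := by
  simp only [quadPot, ← Finset.sum_sub_distrib]
  refine Finset.sum_congr rfl fun i _ => Finset.sum_congr rfl fun j _ => ?_
  have h1 : pd3 (fun x => S i j x - T i j x) j = fun x => pd3 (S i j) j x - pd3 (T i j) j x :=
    funext fun y => pd3_fun_sub (hS i j) (hT i j) j y
  have h2 : pd3 (fun x => pd3 (S i j) j x - pd3 (T i j) j x) i =
      fun x => pd3 (pd3 (S i j) j) i x - pd3 (pd3 (T i j) j) i x :=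
    funext fun y => pd3_fun_sub ((hS i j).pd3 j) ((hT i j).pd3 j) i y
  rw [h1, h2]
  simp only [kpot]
  rw [← integral_sub (integrable_kernel_mul_of_locallyIntegrable locallyIntegrable_newton
    (((hS i j).pd3 j).pd3 i) x) (integrable_kernel_mul_of_locallyIntegrable
    locallyIntegrable_newton (((hT i j).pd3 j).pd3 i) x)]
  simp only [mul_sub]

/-- The half-turn about the axis of symmetry. -/
def halfTurn : E3 ≃ₗᵢ[ℝ] E3 :=
  LinearIsometryEquiv.piLpCongrRight 2 fun i : Fin 3 =>
    if i = 0 then LinearIsometryEquiv.refl ℝ ℝ else LinearIsometryEquiv.neg ℝ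

/-- The sign of the half-turn on each coordinate. -/
def halfTurnSign (i : Fin 3) : ℝ := if i = 0 then 1 else -1

lemma halfTurnSign_sq (i : Fin 3) : halfTurnSign i * halfTurnSign i = 1 := by
  unfold halfTurnSign
  split_ifs <;> norm_num

lemma halfTurn_apply (x : E3) (i : Fin 3) : halfTurn x i = halfTurnSign i * x i := by
  fin_cases i <;> simp [halfTurn, halfTurnSign]

lemma halfTurn_single (i : Fin 3) : halfTurn (EuclideanSpace.single i 1) =
    halfTurnSign i • EuclideanSpace.single i (1 : ℝ) := by
  ext j
  rw [halfTurn_apply]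
  by_cases h : j = i
  · subst h; simp
  · simp [h]

lemma pd3_comp_halfTurn {g : E3 → ℝ} (hg : ContDiff ℝ (⊤ : ℕ∞) g) (i : Fin 3) (x : E3) :
    pd3 (fun y => g (halfTurn y)) i x = halfTurnSign i * pd3 g i (halfTurn x) := by
  have h1 : HasFDerivAt (fun y => halfTurn y)
      (halfTurn.toContinuousLinearEquiv : E3 →L[ℝ] E3) x :=
    (halfTurn.toContinuousLinearEquiv : E3 →L[ℝ] E3).hasFDerivAt
  have h2 := ((hg.differentiable (by simp) (halfTurn x)).hasFDerivAt.comp x h1).fderiv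
  have h3 : fderiv ℝ (fun y => g (halfTurn y)) x = _ := h2
  rw [pd3, h3]
  change fderiv ℝ g (halfTurn x) (halfTurn (EuclideanSpace.single i 1)) = _
  rw [halfTurn_single, map_smul]
  rfl

lemma Rinv_halfTurn (x : E3) : Rinv (halfTurn x) = Rinv x := by
  simp [Rinv, rad, halfTurn_apply, halfTurnSign]

lemma rad_halfTurn (x : E3) : rad (halfTurn x) = rad x := congrArg Prod.snd (Rinv_halfTurn x)

lemma uvf_halfTurn (v₁ v₂ f : Pt → ℝ) (x : E3) (i : Fin 3) :
    uvf v₁ v₂ f (halfTurn x) i = halfTurnSign i * uvf v₁ v₂ f x i := by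
  fin_cases i
  · simp [uvf_zero, Rinv_halfTurn, halfTurnSign]
  · simp [uvf_one, Rinv_halfTurn, rad_halfTurn, halfTurn_apply, halfTurnSign]
    ring
  · simp [uvf_two, Rinv_halfTurn, rad_halfTurn, halfTurn_apply, halfTurnSign]
    ring

lemma kpot_newton_halfTurn {g : E3 → ℝ} (hg : ∀ y, g (halfTurn y) = g y) (x : E3) :
    kpot newton g (halfTurn x) = kpot newton g x := by
  have hn : ∀ z, newton (halfTurn z) = newton z := fun z => by simp [newton]
  rw [kpot, ← halfTurn.measurePreserving.integral_comp
    halfTurn.toHomeomorph.measurableEmbedding]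
  simp only [hg, kpot, ← map_sub, hn]

lemma FlowProfile.pressureFn_halfTurn {v₁ v₂ f : Pt → ℝ} (h : FlowProfile v₁ v₂ f) (x : E3) :
    pressureFn (uvf v₁ v₂ f) (halfTurn x) = pressureFn (uvf v₁ v₂ f) x := by
  have key : ∀ (i j : Fin 3) (y : E3), pd3 (fun z => uvf v₁ v₂ f z j) i (halfTurn y) =
      halfTurnSign i * halfTurnSign j * pd3 (fun z => uvf v₁ v₂ f z j) i y := by
    intro i j y
    have h1 := pd3_comp_halfTurn (h.testFn j).smooth i y
    simp only [uvf_halfTurn] at h1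
    have h2 : pd3 (fun z => halfTurnSign j * uvf v₁ v₂ f z j) i y =
        halfTurnSign j * pd3 (fun z => uvf v₁ v₂ f z j) i y := by
      rw [pd3, fderiv_const_mul ((h.testFn j).smooth.differentiable (by simp) y)]
      rfl
    linear_combination (-(pd3 (fun z => uvf v₁ v₂ f z j) i (halfTurn y))) * halfTurnSign_sq i
      - halfTurnSign i * h1 + halfTurnSign i * h2
  rw [pressureFn_eq_kpot]
  refine kpot_newton_halfTurn (fun y => ?_) x
  refine Finset.sum_congr rfl fun i _ => Finset.sum_congr rfl fun j _ => ?_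
  rw [key i j, key j i]
  linear_combination (pd3 (fun z => uvf v₁ v₂ f z j) i y * pd3 (fun z => uvf v₁ v₂ f z i) j y) *
    ((halfTurnSign_sq i) * (halfTurnSign j * halfTurnSign j) + halfTurnSign_sq j)

lemma FlowProfile.pd3_pressureFn_axis {v₁ v₂ f : Pt → ℝ} (h : FlowProfile v₁ v₂ f) (t : ℝ) :
    pd3 (pressureFn (uvf v₁ v₂ f)) 1 (e3 t 0 0) = 0 := by
  have hs : ContDiff ℝ (⊤ : ℕ∞) (pressureFn (uvf v₁ v₂ f)) := by
    rw [h.pressureFn_eq]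
    exact contDiff_quadPot fun i j => (h.testFn i).mul (h.testFn j)
  have h1 := pd3_comp_halfTurn hs 1 (e3 t 0 0)
  simp only [h.pressureFn_halfTurn] at h1
  have h2 : halfTurn (e3 t 0 0) = e3 t 0 0 := by
    ext i
    rw [halfTurn_apply]
    fin_cases i <;> simp [halfTurnSign, e3_apply_zero, e3_apply_one, e3_apply_two]
  have h3 : halfTurnSign 1 = -1 := by simp [halfTurnSign]
  rw [h2, h3] at h1
  have h4 : pd3 (fun y => pressureFn (uvf v₁ v₂ f) y) 1 (e3 t 0 0) =
    pd3 (pressureFn (uvf v₁ v₂ f)) 1 (e3 t 0 0) := rfl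
  linarith

section Asymptotics

variable {h : ℝ → ℝ} {D K R : ℝ}

lemma abs_pow_mul_sub_le_of_leading
    (hl : ∀ t, R < |t| → |h t - D * (t / |t| ^ 5)| ≤ K / |t| ^ 5) {t : ℝ} (ht : R < |t|)
    (h0 : t ≠ 0) : |t ^ 4 * h t - D * (t / |t|)| ≤ K / |t| := by
  have ha : 0 < |t| := abs_pos.2 h0
  have h4 : t ^ 4 = |t| ^ 4 := by rw [← abs_pow, abs_of_nonneg (by positivity)]
  have e : t ^ 4 * h t - D * (t / |t|) = |t| ^ 4 * (h t - D * (t / |t| ^ 5)) := by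
    rw [h4]
    field_simp
  rw [e, abs_mul, abs_of_pos (by positivity)]
  calc |t| ^ 4 * |h t - D * (t / |t| ^ 5)| ≤ |t| ^ 4 * (K / |t| ^ 5) := by
        gcongr
        exact hl t ht
    _ = K / |t| := by field_simp

lemma tendsto_atTop_of_leading
    (hl : ∀ t, R < |t| → |h t - D * (t / |t| ^ 5)| ≤ K / |t| ^ 5) :
    Tendsto (fun t => t ^ 4 * h t) atTop (𝓝 D) := by
  rw [tendsto_iff_norm_sub_tendsto_zero]
  refine squeeze_zero' (.of_forall fun _ => norm_nonneg _) ?_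
    (tendsto_const_nhds.div_atTop (a := K) tendsto_abs_atTop_atTop)
  filter_upwards [eventually_gt_atTop 0, eventually_gt_atTop R] with t h0 hR
  have := abs_pow_mul_sub_le_of_leading hl (hR.trans_le (le_abs_self t)) h0.ne'
  have e : t / |t| = 1 := by
    rw [abs_of_pos h0, div_self h0.ne']
  rwa [e, mul_one] at this

lemma tendsto_atBot_of_leading
    (hl : ∀ t, R < |t| → |h t - D * (t / |t| ^ 5)| ≤ K / |t| ^ 5) :
    Tendsto (fun t => t ^ 4 * h t) atBot (𝓝 (-D)) := by
  rw [tendsto_iff_norm_sub_tendsto_zero]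
  refine squeeze_zero' (.of_forall fun _ => norm_nonneg _) ?_
    (tendsto_const_nhds.div_atTop (a := K) tendsto_abs_atBot_atTop)
  filter_upwards [eventually_lt_atBot 0, eventually_lt_atBot (-R)] with t h0 hR
  have := abs_pow_mul_sub_le_of_leading hl (by rw [abs_of_neg h0]; linarith) h0.ne
  have e : t / |t| = -1 := by
    rw [abs_of_neg h0, div_neg, div_self h0.ne]
  rwa [e, mul_neg_one] at this

lemma exists_pos_max (hc : Continuous h) (hD : 0 < D)
    (hl : Tendsto (fun t => t ^ 4 * h t) atTop (𝓝 D))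
    (hb : ∀ t, t ≠ 0 → |h t| ≤ K / |t| ^ 4) :
    ∃ A B : ℝ, 0 < B ∧ h A = B ∧ ∀ t, h t ≤ B := by
  obtain ⟨t₀, ht₀, hp₀⟩ := ((hl.eventually (lt_mem_nhds hD)).and (eventually_gt_atTop 0)).exists
  have hp : 0 < h t₀ := pos_of_mul_pos_right ht₀ (by positivity)
  have hz : Tendsto (fun t : ℝ => K / |t| ^ 4) (cocompact ℝ) (𝓝 0) :=
    tendsto_const_nhds.div_atTop
      ((tendsto_pow_atTop (by norm_num)).comp (tendsto_norm_cocompact_atTop (E := ℝ)))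
  have hev : ∀ᶠ t in cocompact ℝ, h t ≤ h t₀ := by
    filter_upwards [hz.eventually (gt_mem_nhds hp),
      (finite_singleton (0 : ℝ)).isCompact.compl_mem_cocompact] with t h1 h2
    exact (le_abs_self _).trans ((hb t h2).trans h1.le)
  obtain ⟨A, hA⟩ := hc.exists_forall_ge' t₀ hev
  exact ⟨A, h A, hp.trans_le (hA t₀), rfl, hA⟩

end Asymptotics

lemma exists_uniform_asymptotics {F : ℝ → ℝ → ℝ} {D K R : ℝ} (hD : 0 < D)
    (hF : ∀ t s, R < t → 0 < t → |s| < 1 → |F t s - D / t ^ 4| ≤ K / t ^ 5) (κ : ℝ) :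
    ∃ N : ℝ, 0 < N ∧ ∀ n : ℝ, N ≤ n → ∀ t s : ℝ, |t - n| < κ → |s| < 1 →
      |F t s - D / n ^ 4| ≤ 0.001 * (D / n ^ 4) := by
  refine ⟨max 1 (max (10 ^ 5 * κ) (max (2 * R) (2 * (10 ^ 4 * K / D)) + 1)), by positivity, ?_⟩
  intro n hn t s ht hs
  have hn1 : 1 ≤ n := (le_max_left _ _).trans hn
  have hn' := (le_max_right _ _).trans hn
  have hκ : 10 ^ 5 * κ ≤ n := (le_max_left _ _).trans hn'
  have hn2 := (le_max_right _ _).trans hn'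
  have hR : 2 * R + 1 ≤ n := (by gcongr; exact le_max_left _ _ : _ ≤ _).trans hn2
  have hK : 2 * (10 ^ 4 * K / D) + 1 ≤ n := (by gcongr; exact le_max_right _ _ : _ ≤ _).trans hn2
  obtain ⟨ht1, ht2⟩ := abs_lt.1 ht
  have htn : 0.99999 * n ≤ t := by linarith
  have htn' : t ≤ 1.00001 * n := by linarith
  have ht0 : 0 < t := by linarith
  have hn0 : 0 < n := by linarith
  have hmain := hF t s (by linarith) ht0 hs
  have hρ1 : n / t ≤ 1.0001 := by
    rw [div_le_iff₀ ht0]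
    linarith
  have hρ2 : 0.9999 ≤ n / t := by
    rw [le_div_iff₀ ht0]
    linarith
  have hρ3 : (n / t) ^ 4 ≤ 1.0005 :=
    (pow_le_pow_left₀ (by positivity) hρ1 4).trans (by norm_num)
  have hρ4 : 0.9995 ≤ (n / t) ^ 4 :=
    le_trans (by norm_num) (pow_le_pow_left₀ (by norm_num) hρ2 4)
  have hKt : K / t ≤ 0.0001 * D := by
    have : 10 ^ 4 * K / D ≤ t := by linarith
    rw [div_le_iff₀ hD] at this
    rw [div_le_iff₀ ht0]
    linarith
  have hP : 0 < D / n ^ 4 := by positivity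
  have e1 : D / t ^ 4 = D / n ^ 4 * (n / t) ^ 4 := by field_simp
  have e2 : K / t ^ 5 = K / t * ((n / t) ^ 4 / n ^ 4) := by field_simp
  have h2 : K / t ^ 5 ≤ 0.0001 * (D / n ^ 4) * (n / t) ^ 4 := by
    rw [e2]
    calc K / t * ((n / t) ^ 4 / n ^ 4) ≤ 0.0001 * D * ((n / t) ^ 4 / n ^ 4) := by gcongr
      _ = _ := by ring
  obtain ⟨h3, h4⟩ := abs_le.1 hmain
  rw [e1] at h3 h4
  rw [abs_le]
  constructor <;> nlinarith [mul_le_mul_of_nonneg_left hρ3 hP.le,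
    mul_le_mul_of_nonneg_left hρ4 hP.le]

/-- The embedding of the plane as `{x₃ = 0}`. -/
def planeEmb : Pt →L[ℝ] E3 :=
  (ContinuousLinearMap.fst ℝ ℝ ℝ).smulRight (EuclideanSpace.single 0 1) +
    (ContinuousLinearMap.snd ℝ ℝ ℝ).smulRight (EuclideanSpace.single 1 1)

lemma planeEmb_apply (q : Pt) : planeEmb q = e3 q.1 q.2 0 := by
  ext i
  fin_cases i <;> simp [planeEmb, e3_apply_zero, e3_apply_one, e3_apply_two]

lemma norm_planeEmb (q : Pt) : ‖planeEmb q‖ = √(q.1 ^ 2 + q.2 ^ 2) := by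
  rw [← Real.sqrt_sq (norm_nonneg _), norm_sq_coords, planeEmb_apply]
  simp [e3_apply_zero, e3_apply_one, e3_apply_two]

lemma planeEmb_ne_zero {q : Pt} (hq : q ≠ 0) : planeEmb q ≠ 0 := by
  intro h
  apply hq
  rw [planeEmb_apply] at h
  exact Prod.ext (congrArg (fun x : E3 => x 0) h) (congrArg (fun x : E3 => x 1) h)

lemma abs_fst_le_norm_planeEmb (q : Pt) : |q.1| ≤ ‖planeEmb q‖ := by
  rw [norm_planeEmb]
  exact Real.abs_le_sqrt (by nlinarith [sq_nonneg q.2])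

lemma hasFDerivAt_comp_planeEmb {g : E3 → ℝ} (hg : ContDiff ℝ (⊤ : ℕ∞) g) (q : Pt) :
    HasFDerivAt (fun q => g (planeEmb q)) ((fderiv ℝ g (planeEmb q)).comp planeEmb) q :=
  (hg.differentiable (by simp) _).hasFDerivAt.comp q planeEmb.hasFDerivAt

lemma pdx_comp_planeEmb {g : E3 → ℝ} (hg : ContDiff ℝ (⊤ : ℕ∞) g) (q : Pt) :
    pdx (fun q => g (planeEmb q)) q = pd3 g 0 (planeEmb q) := by
  rw [pdx, (hasFDerivAt_comp_planeEmb hg q).fderiv]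
  simp [planeEmb, pd3]

lemma pdy_comp_planeEmb {g : E3 → ℝ} (hg : ContDiff ℝ (⊤ : ℕ∞) g) (q : Pt) :
    pdy (fun q => g (planeEmb q)) q = pd3 g 1 (planeEmb q) := by
  rw [pdy, (hasFDerivAt_comp_planeEmb hg q).fderiv]
  simp [planeEmb, pd3]

lemma norm_fderiv_comp_planeEmb_le {g : E3 → ℝ} (hg : ContDiff ℝ (⊤ : ℕ∞) g) {q : Pt} {B : ℝ}
    (h0 : |pd3 g 0 (planeEmb q)| ≤ B) (h1 : |pd3 g 1 (planeEmb q)| ≤ B) :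
    ‖fderiv ℝ (fun q => g (planeEmb q)) q‖ ≤ 2 * B := by
  have hB : 0 ≤ B := (abs_nonneg _).trans h0
  refine ContinuousLinearMap.opNorm_le_bound _ (by positivity) fun w => ?_
  obtain ⟨a, b⟩ := w
  rw [fderiv_eq_pdx_pdy, pdx_comp_planeEmb hg, pdy_comp_planeEmb hg, Real.norm_eq_abs]
  have ha : |a| ≤ ‖((a, b) : Pt)‖ := norm_fst_le (a, b)
  have hb : |b| ≤ ‖((a, b) : Pt)‖ := norm_snd_le (a, b)
  calc _ ≤ |a| * |pd3 g 0 (planeEmb q)| + |b| * |pd3 g 1 (planeEmb q)| := by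
        refine (abs_add_le _ _).trans ?_
        rw [abs_mul, abs_mul]
    _ ≤ ‖((a, b) : Pt)‖ * B + ‖((a, b) : Pt)‖ * B := by gcongr
    _ = _ := by ring

section Structure

variable {U : Set Pt} {w₁ w₂ f φ : Pt → ℝ}

lemma StructureOn.mem_of_phi_eq_one (hS : StructureOn U w₁ w₂ f φ) {p : Pt} (hp : φ p = 1) :
    p ∈ U :=
  hS.supp_phi (subset_tsupport φ (by simp [Function.mem_support, hp]))

lemma StructureOn.tsupport_fst_subset (hS : StructureOn U w₁ w₂ f φ) : tsupport w₁ ⊆ U :=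
  fun _ hp => hS.mem_of_phi_eq_one (hS.supp_w₁ hp)

lemma StructureOn.tsupport_snd_subset (hS : StructureOn U w₁ w₂ f φ) : tsupport w₂ ⊆ U :=
  fun _ hp => hS.mem_of_phi_eq_one (hS.supp_w₂ hp)

lemma StructureOn.sq_add_sq_lt (hS : StructureOn U w₁ w₂ f φ) {p : Pt} (hp : p ∈ U) :
    w₁ p ^ 2 + w₂ p ^ 2 < f p ^ 2 :=
  (Real.sqrt_lt' ((Real.sqrt_nonneg _).trans_lt (hS.f_gt p hp))).1 (hS.f_gt p hp)

lemma StructureOn.flowProfile (hS : StructureOn U w₁ w₂ f φ) (hUP : closure U ⊆ Pset) :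
    FlowProfile w₁ w₂ f := by
  have hout₁ : ∀ p, p ∉ U → w₁ =ᶠ[𝓝 p] 0 := fun p hp =>
    notMem_tsupport_iff_eventuallyEq.1 fun h => hp (hS.tsupport_fst_subset h)
  have hout₂ : ∀ p, p ∉ U → w₂ =ᶠ[𝓝 p] 0 := fun p hp =>
    notMem_tsupport_iff_eventuallyEq.1 fun h => hp (hS.tsupport_snd_subset h)
  have hsupp : Function.support (wcomp w₁ w₂ f) ⊆ Function.support f := by
    intro p hp hf
    refine hp ?_
    rw [wcomp, hf]
    exact Real.sqrt_eq_zero_of_nonpos (by nlinarith [sq_nonneg (w₁ p), sq_nonneg (w₂ p)])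
  refine ⟨⟨hS.smooth_w₁, hS.hcs_w₁, hS.tsupport_fst_subset.trans (subset_closure.trans hUP)⟩,
    ⟨hS.smooth_w₂, hS.hcs_w₂, hS.tsupport_snd_subset.trans (subset_closure.trans hUP)⟩,
    ⟨?_, hS.hcs_f.mono hsupp, ?_⟩, ?_, ?_⟩
  · rw [contDiff_iff_contDiffAt]
    intro p
    by_cases hp : p ∈ U
    · refine ContDiffAt.sqrt ((hS.smooth_f.contDiffAt.pow 2).sub
        ((hS.smooth_w₁.contDiffAt.pow 2).add (hS.smooth_w₂.contDiffAt.pow 2))) ?_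
      have := hS.sq_add_sq_lt hp
      exact (sub_pos.2 this).ne'
    · refine hS.smooth_f.contDiffAt.congr_of_eventuallyEq ?_
      filter_upwards [hout₁ p hp, hout₂ p hp] with y h1 h2
      rw [wcomp, h1, h2]
      simp [Real.sqrt_sq (hS.f_nonneg y)]
  · refine (closure_mono hsupp).trans ?_
    change tsupport f ⊆ _
    rw [hS.supp_f]
    exact hUP
  · intro p
    by_cases hp : p ∈ U
    · exact hS.div_v p hp
    · rw [div2w_eq hS.smooth_w₁ hS.smooth_w₂, pdx, pdy, (hout₁ p hp).fderiv_eq,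
        (hout₂ p hp).fderiv_eq, (hout₂ p hp).eq_of_nhds]
      simp
  · intro p
    by_cases hp : p ∈ U
    · exact (hS.sq_add_sq_lt hp).le
    · rw [(hout₁ p hp).eq_of_nhds, (hout₂ p hp).eq_of_nhds]
      simpa using sq_nonneg (f p)

lemma wcomp_zero_zero (hf : ∀ p, 0 ≤ f p) : wcomp zf zf f = f := by
  ext p
  simp [wcomp, zf, Real.sqrt_sq (hf p)]

lemma StructureOn.flowProfile_zero (hS : StructureOn U w₁ w₂ f φ) (hUP : closure U ⊆ Pset) :
    FlowProfile zf zf f := by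
  have hz : SmoothCompSuppP zf := by
    refine ⟨contDiff_const, HasCompactSupport.zero, ?_⟩
    have : tsupport zf = ∅ := tsupport_eq_empty_iff.2 rfl
    rw [this]
    exact empty_subset _
  refine ⟨hz, hz, ?_, ?_, ?_⟩
  · rw [wcomp_zero_zero hS.f_nonneg]
    exact ⟨hS.smooth_f, hS.hcs_f, hS.supp_f.trans_subset hUP⟩
  · intro p
    have h : fderiv ℝ zf p = 0 := fderiv_const_apply (0 : ℝ)
    rw [div2w_eq hz.1 hz.1, pdx, pdy, h]
    simp [zf]
  · intro p
    simpa [zf] using sq_nonneg (f p)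

lemma StructureOn.Dconst_pos (hS : StructureOn U w₁ w₂ f φ) (hUP : closure U ⊆ Pset)
    (hw₁ : ∃ p, w₁ p ≠ 0) : 0 < Dconst w₁ := by
  obtain ⟨p, hp⟩ := hw₁
  have hF := hS.flowProfile hUP
  have hT := (hF.testFn 0).mul (hF.testFn 0)
  have hpos : 0 < p.2 := hF.fst.2.2 (subset_tsupport _ hp)
  have hR : Rinv (e3 p.1 p.2 0) = p := by
    simp [Rinv, rad, e3_apply_zero, e3_apply_one, e3_apply_two, Real.sqrt_sq hpos.le]
  have := hT.smooth.continuous.integral_pos_of_hasCompactSupport_nonneg_nonzero (μ := volume)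
    hT.compact (fun x => mul_self_nonneg _) (x := e3 p.1 p.2 0)
    (by rw [uvf_zero, hR]; exact mul_self_ne_zero.2 hp)
  simp only [uvf_zero, ← pow_two] at this
  rw [Dconst]
  positivity

/-- The difference of the momentum flux tensors of `u[v,f]` and `u[0,f]`. -/
def fluxDiff (w₁ w₂ f : Pt → ℝ) (i j : Fin 3) (x : E3) : ℝ :=
  uvf w₁ w₂ f x i * uvf w₁ w₂ f x j - uvf zf zf f x i * uvf zf zf f x j

lemma fluxDiff_zero_zero (w₁ w₂ f : Pt → ℝ) (x : E3) :
    fluxDiff w₁ w₂ f 0 0 x = w₁ (Rinv x) ^ 2 := by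
  simp [fluxDiff, uvf_zero, zf, pow_two]

lemma fluxDiff_trace (hF : FlowProfile w₁ w₂ f) (hf : ∀ p, 0 ≤ f p) (x : E3) :
    fluxDiff w₁ w₂ f 1 1 x + fluxDiff w₁ w₂ f 2 2 x = - fluxDiff w₁ w₂ f 0 0 x := by
  rw [fluxDiff_zero_zero]
  simp only [fluxDiff, uvf_one, uvf_two, wcomp_zero_zero hf, zf, zero_mul, zero_sub, zero_add]
  rcases (rad_nonneg x).eq_or_lt with h0 | h0
  · have : w₁ (Rinv x) = 0 := image_eq_zero_of_notMem_tsupport fun hm => by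
      have h1 : 0 < rad x := hF.fst.2.2 hm
      exact h1.ne h0
    rw [this, ← h0]
    simp
  · have hw : wcomp w₁ w₂ f (Rinv x) ^ 2 =
        f (Rinv x) ^ 2 - (w₁ (Rinv x) ^ 2 + w₂ (Rinv x) ^ 2) :=
      Real.sq_sqrt (sub_nonneg.2 (hF.le _))
    have hr : (x 1 / rad x) ^ 2 + (x 2 / rad x) ^ 2 = 1 := by
      rw [div_pow, div_pow, ← add_div, ← rad_sq, div_self (by positivity)]
    linear_combination ((x 1 / rad x) ^ 2 + (x 2 / rad x) ^ 2) * hw -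
      (w₁ (Rinv x) ^ 2) * hr

lemma testFn_fluxDiff (hF : FlowProfile w₁ w₂ f) (h0 : FlowProfile zf zf f) (i j : Fin 3) :
    TestFn (fluxDiff w₁ w₂ f i j) :=
  ((hF.testFn i).mul (hF.testFn j)).sub ((h0.testFn i).mul (h0.testFn j))

lemma pd3_quadPot_fluxDiff (hF : FlowProfile w₁ w₂ f) (h0 : FlowProfile zf zf f) (l : Fin 3)
    (x : E3) : pd3 (quadPot (fluxDiff w₁ w₂ f)) l x =
      pd3 (pressureFn (uvf w₁ w₂ f)) l x - pd3 (pressureFn (uvf zf zf f)) l x := by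
  have hT := fun i j => (hF.testFn i).mul (hF.testFn j)
  have hT0 := fun i j => (h0.testFn i).mul (h0.testFn j)
  have e : quadPot (fluxDiff w₁ w₂ f) = fun x =>
      quadPot (fun i j x => uvf w₁ w₂ f x i * uvf w₁ w₂ f x j) x -
        quadPot (fun i j x => uvf zf zf f x i * uvf zf zf f x j) x :=
    funext fun x => quadPot_sub hT hT0 x
  rw [e, hF.pressureFn_eq, h0.pressureFn_eq, pd3,
    fderiv_fun_sub ((contDiff_quadPot hT).differentiable (by simp) x)
      ((contDiff_quadPot hT0).differentiable (by simp) x)]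
  rfl

lemma FlowProfile.contDiff_pressureFn (hF : FlowProfile w₁ w₂ f) :
    ContDiff ℝ (⊤ : ℕ∞) (pressureFn (uvf w₁ w₂ f)) := by
  rw [hF.pressureFn_eq]
  exact contDiff_quadPot fun i j => (hF.testFn i).mul (hF.testFn j)

lemma pvf_eq (w₁ w₂ f : Pt → ℝ) :
    pvf w₁ w₂ f = fun q => pressureFn (uvf w₁ w₂ f) (planeEmb q) := by
  ext q
  rw [pvf, planeEmb_apply]

lemma Fpi1_eq (hF : FlowProfile w₁ w₂ f) (h0 : FlowProfile zf zf f) (q : Pt) :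
    Fpi1 w₁ w₂ f q = -pd3 (quadPot (fluxDiff w₁ w₂ f)) 0 (planeEmb q) := by
  rw [Fpi1, pd3_quadPot_fluxDiff hF h0, pvf_eq, pvf_eq, pdx_comp_planeEmb hF.contDiff_pressureFn,
    pdx_comp_planeEmb h0.contDiff_pressureFn]
  ring

lemma Fpi2_eq (hF : FlowProfile w₁ w₂ f) (h0 : FlowProfile zf zf f) (q : Pt) :
    Fpi2 w₁ w₂ f q = -pd3 (quadPot (fluxDiff w₁ w₂ f)) 1 (planeEmb q) := by
  rw [Fpi2, pd3_quadPot_fluxDiff hF h0, pvf_eq, pvf_eq, pdy_comp_planeEmb hF.contDiff_pressureFn,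
    pdy_comp_planeEmb h0.contDiff_pressureFn]
  ring

lemma Fpi1_leading (hF : FlowProfile w₁ w₂ f) (h0 : FlowProfile zf zf f) (hf : ∀ p, 0 ≤ f p) :
    ∃ K R : ℝ, ∀ t : ℝ, R < |t| →
      |Fpi1 w₁ w₂ f (t, 0) - Dconst w₁ * (t / |t| ^ 5)| ≤ K / |t| ^ 5 := by
  have hT := testFn_fluxDiff hF h0
  obtain ⟨K, R, hK⟩ := pd3_quadPot_leading hT 0
  refine ⟨K, max R 0, fun t ht => ?_⟩
  have ht0 : t ≠ 0 := abs_pos.1 ((le_max_right _ _).trans_lt ht)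
  have h := hK (e3 t 0 0) (by rw [norm_e3_axis]; exact (le_max_left _ _).trans_lt ht)
  rw [sum_pd3_newton_axis ht0 fun i j => ∫ y, fluxDiff w₁ w₂ f i j y, norm_e3_axis,
    ← integral_add (hT 1 1).integrable (hT 2 2).integrable] at h
  simp only [fluxDiff_trace hF hf, integral_neg, fluxDiff_zero_zero] at h
  rw [Fpi1_eq hF h0, planeEmb_apply, ← abs_neg, Dconst]
  refine le_trans (le_of_eq ?_) h
  congr 1
  ring

end Structure

/-- Lemma 3.4: properties of the pressure interaction function `F[v,f]`. -/
theorem statement_8 (U : Set Pt) (hUo : IsOpen U) (hUc : IsCompact (closure U))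
    (hUP : closure U ⊆ Pset) (w₁ w₂ f φ : Pt → ℝ)
    (hS : StructureOn U w₁ w₂ f φ) (hw₁ : ∃ p, w₁ p ≠ 0) :
    (ContDiff ℝ (⊤ : ℕ∞) (fun q : Pt => (Fpi1 w₁ w₂ f q, Fpi2 w₁ w₂ f q)) ∧
      0 < Dconst w₁ ∧
      Tendsto (fun x₁ : ℝ => x₁ ^ 4 * Fpi1 w₁ w₂ f (x₁, 0)) atTop (nhds (Dconst w₁)) ∧
      Tendsto (fun x₁ : ℝ => x₁ ^ 4 * Fpi1 w₁ w₂ f (x₁, 0)) atBot (nhds (-(Dconst w₁)))) ∧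
    (∃ A B : ℝ, 0 < B ∧ Fpi1 w₁ w₂ f (A, 0) = B ∧ ∀ x₁ : ℝ, Fpi1 w₁ w₂ f (x₁, 0) ≤ B) ∧
    (∀ x₁ : ℝ, Fpi2 w₁ w₂ f (x₁, 0) = 0) ∧
    (∃ C : ℝ, 0 < C ∧
      (∀ q : Pt, q ≠ 0 →
        Real.sqrt (Fpi1 w₁ w₂ f q ^ 2 + Fpi2 w₁ w₂ f q ^ 2)
            ≤ C / Real.sqrt (q.1 ^ 2 + q.2 ^ 2) ^ 4 ∧
        ‖fderiv ℝ (fun q' : Pt => (Fpi1 w₁ w₂ f q', Fpi2 w₁ w₂ f q')) q‖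
            ≤ C / Real.sqrt (q.1 ^ 2 + q.2 ^ 2) ^ 5) ∧
      (∃ N : ℝ, 0 < N ∧ ∀ n : ℝ, N ≤ n → ∀ x₁ x₂ : ℝ,
        |x₁ - n| < 10 ^ 4 * C / Dconst w₁ → |x₂| < 1 →
        |Fpi1 w₁ w₂ f (x₁, x₂) - Dconst w₁ / n ^ 4|
            ≤ 0.001 * (Dconst w₁ / n ^ 4))) := by
  have hF := hS.flowProfile hUP
  have h0 := hS.flowProfile_zero hUP
  have hT := testFn_fluxDiff hF h0
  have hQ := contDiff_quadPot hT
  have hD := hS.Dconst_pos hUP hw₁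
  have hs : ∀ l, ContDiff ℝ (⊤ : ℕ∞) fun x => -pd3 (quadPot (fluxDiff w₁ w₂ f)) l x :=
    fun l => (contDiff_pd3 hQ l).neg
  have e₁ : Fpi1 w₁ w₂ f = fun q => -pd3 (quadPot (fluxDiff w₁ w₂ f)) 0 (planeEmb q) :=
    funext (Fpi1_eq hF h0)
  have e₂ : Fpi2 w₁ w₂ f = fun q => -pd3 (quadPot (fluxDiff w₁ w₂ f)) 1 (planeEmb q) :=
    funext (Fpi2_eq hF h0)
  have c₁ : ContDiff ℝ (⊤ : ℕ∞) (Fpi1 w₁ w₂ f) := e₁ ▸ (hs 0).comp planeEmb.contDiff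
  have c₂ : ContDiff ℝ (⊤ : ℕ∞) (Fpi2 w₁ w₂ f) := e₂ ▸ (hs 1).comp planeEmb.contDiff
  obtain ⟨K, R, hK⟩ := Fpi1_leading hF h0 hS.f_nonneg
  have htop := tendsto_atTop_of_leading hK
  choose C₄ hC₄ hb₄ using fun l => pd3_quadPot_bound hT l
  choose C₅ hC₅ hb₅ using fun l m => pd3_pd3_quadPot_bound hT l m
  set B := C₅ 0 0 + C₅ 0 1 + C₅ 1 0 + C₅ 1 1 with hB
  have hneg : ∀ l m x, |pd3 (fun x => -pd3 (quadPot (fluxDiff w₁ w₂ f)) l x) m x| =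
      |pd3 (pd3 (quadPot (fluxDiff w₁ w₂ f)) l) m x| := by
    intro l m x
    rw [pd3, fderiv_fun_neg, neg_apply, abs_neg]
    rfl
  have hgrad : ∀ l, l = 0 ∨ l = 1 → ∀ q : Pt, q ≠ 0 →
      ‖fderiv ℝ (fun q => -pd3 (quadPot (fluxDiff w₁ w₂ f)) l (planeEmb q)) q‖
        ≤ 2 * (B / ‖planeEmb q‖ ^ 5) := by
    intro l hl q hq
    have hle : ∀ m, m = 0 ∨ m = 1 → C₅ l m ≤ B := by
      have := hC₅ 0 0
      have := hC₅ 0 1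
      have := hC₅ 1 0
      have := hC₅ 1 1
      rintro m (rfl | rfl) <;> rcases hl with rfl | rfl <;> linarith
    refine norm_fderiv_comp_planeEmb_le (hs l) ?_ ?_
    · rw [hneg]
      refine (hb₅ l 0 _ (planeEmb_ne_zero hq)).trans ?_
      gcongr
      exact hle 0 (.inl rfl)
    · rw [hneg]
      refine (hb₅ l 1 _ (planeEmb_ne_zero hq)).trans ?_
      gcongr
      exact hle 1 (.inr rfl)
  have hBpos : 0 < B := by
    have := hC₅ 0 0
    have := hC₅ 0 1
    have := hC₅ 1 0
    have := hC₅ 1 1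
    linarith
  have hC₀ := hC₄ 0
  have hC₁ := hC₄ 1
  refine ⟨⟨c₁.prodMk c₂, hD, htop, tendsto_atBot_of_leading hK⟩, ?_, ?_,
    C₄ 0 + C₄ 1 + 2 * B, by positivity, ?_, ?_⟩
  · refine exists_pos_max (h := fun t => Fpi1 w₁ w₂ f (t, 0)) (K := C₄ 0)
      (c₁.continuous.comp (by fun_prop)) hD htop fun t ht => ?_
    have hq : ((t, 0) : Pt) ≠ 0 := fun h => ht (congrArg Prod.fst h)
    have := hb₄ 0 _ (planeEmb_ne_zero hq)
    rw [e₁, abs_neg]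
    refine this.trans (le_of_eq ?_)
    rw [planeEmb_apply, norm_e3_axis]
  · intro t
    rw [Fpi2_eq hF h0, pd3_quadPot_fluxDiff hF h0, planeEmb_apply, hF.pd3_pressureFn_axis,
      h0.pd3_pressureFn_axis]
    simp
  · intro q hq
    rw [← norm_planeEmb]
    have hn : 0 < ‖planeEmb q‖ := norm_pos_iff.2 (planeEmb_ne_zero hq)
    constructor
    · have b₁ : |Fpi1 w₁ w₂ f q| ≤ C₄ 0 / ‖planeEmb q‖ ^ 4 := by
        rw [e₁, abs_neg]
        exact hb₄ 0 _ (planeEmb_ne_zero hq)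
      have b₂ : |Fpi2 w₁ w₂ f q| ≤ C₄ 1 / ‖planeEmb q‖ ^ 4 := by
        rw [e₂, abs_neg]
        exact hb₄ 1 _ (planeEmb_ne_zero hq)
      have hsum : √(Fpi1 w₁ w₂ f q ^ 2 + Fpi2 w₁ w₂ f q ^ 2) ≤
          |Fpi1 w₁ w₂ f q| + |Fpi2 w₁ w₂ f q| := by
        refine Real.sqrt_le_iff.2 ⟨by positivity, ?_⟩
        rw [← sq_abs (Fpi1 w₁ w₂ f q), ← sq_abs (Fpi2 w₁ w₂ f q)]
        nlinarith [mul_nonneg (abs_nonneg (Fpi1 w₁ w₂ f q)) (abs_nonneg (Fpi2 w₁ w₂ f q))]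
      calc _ ≤ _ := hsum
        _ ≤ C₄ 0 / ‖planeEmb q‖ ^ 4 + C₄ 1 / ‖planeEmb q‖ ^ 4 := add_le_add b₁ b₂
        _ = (C₄ 0 + C₄ 1) / ‖planeEmb q‖ ^ 4 := by ring
        _ ≤ _ := div_le_div_of_nonneg_right (by linarith) (by positivity)
    · have d₁ := (c₁.differentiable (by simp) q).hasFDerivAt
      have d₂ := (c₂.differentiable (by simp) q).hasFDerivAt
      rw [(d₁.prodMk d₂).fderiv]
      refine (ContinuousLinearMap.opNorm_prod _ _).le.trans ?_
      rw [Prod.norm_def]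
      have g₁ := hgrad 0 (.inl rfl) q hq
      have g₂ := hgrad 1 (.inr rfl) q hq
      rw [← e₁] at g₁
      rw [← e₂] at g₂
      refine (max_le g₁ g₂).trans ?_
      rw [← mul_div_assoc]
      gcongr
      linarith
  · refine exists_uniform_asymptotics (F := fun t s => Fpi1 w₁ w₂ f (t, s)) (K := K + 2 * B)
      (R := R) hD (fun t s htR ht hs1 => ?_) _
    have ha : |t| = t := abs_of_pos ht
    have h1 := hK t (by rwa [ha])
    rw [ha] at h1
    have e₃ : t / t ^ 5 = 1 / t ^ 4 := by field_simp
    rw [e₃, mul_one_div] at h1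
    have hconv : Convex ℝ {q : Pt | q.1 = t} := by
      intro x hx y hy a b _ _ hab
      simp only [mem_ofPred_eq] at hx hy ⊢
      simp only [Prod.fst_add, Prod.smul_fst, hx, hy, smul_eq_mul]
      rw [← add_mul, hab, one_mul]
    have hmv := hconv.norm_image_sub_le_of_norm_fderiv_le (𝕜 := ℝ) (f := Fpi1 w₁ w₂ f)
      (C := 2 * (B / t ^ 5)) (x := (t, 0)) (y := (t, s))
      (fun q _ => c₁.differentiable (by simp) q) (fun q hq => ?_) rfl rfl
    · have hns : ‖((t, s) : Pt) - (t, 0)‖ ≤ 1 := by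
        simpa [Prod.norm_def] using hs1.le
      have h2 : |Fpi1 w₁ w₂ f (t, s) - Fpi1 w₁ w₂ f (t, 0)| ≤ 2 * (B / t ^ 5) :=
        hmv.trans (mul_le_of_le_one_right (by positivity) hns)
      calc |Fpi1 w₁ w₂ f (t, s) - Dconst w₁ / t ^ 4|
          ≤ |Fpi1 w₁ w₂ f (t, s) - Fpi1 w₁ w₂ f (t, 0)|
            + |Fpi1 w₁ w₂ f (t, 0) - Dconst w₁ / t ^ 4| := abs_sub_le _ _ _
        _ ≤ 2 * (B / t ^ 5) + K / t ^ 5 := add_le_add h2 h1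
        _ = (K + 2 * B) / t ^ 5 := by ring
    · have hq1 : q.1 = t := hq
      have hq0 : q ≠ 0 := fun h => ht.ne' (by rw [← hq1, h]; rfl)
      have := hgrad 0 (.inl rfl) q hq0
      rw [← e₁] at this
      refine this.trans ?_
      have hle := abs_fst_le_norm_planeEmb q
      rw [hq1, ha] at hle
      gcongr
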